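/- arXiv:2202.07748 — 3 statements merged into one kernel-verified Lean document; each statement's English description precedes it below -/
import Mathlib

section
/- Assume the parameter condition and that 𝒢(s) > 0 for all s ∈ (s₋∞,1). Then there exists exactly one v > 0 for which a travelling-wave solution with speed v exists. -/
/-- A travelling-wave solution with speed `v`: `(M,S) : ℝ → [0,1) × (0,1]`,
`S` is `C¹` with `S' = (γ/v) f(S) M`, `M` is continuous and wherever `M > 0` it is
differentiable with `D(M) M' = (v/γ)((1 − S − λF(S)) − γM)`, `M ≡ 0` and `S ≡ 1`
on `[0,∞)`, and `M → 0`, `S → s₋∞` as `ξ → −∞`. -/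
def IsTW (lam gam v sInf : ℝ) (f F D M S : ℝ → ℝ) : Prop :=
  (∀ ξ, M ξ ∈ Set.Ico (0:ℝ) 1) ∧ (∀ ξ, S ξ ∈ Set.Ioc (0:ℝ) 1) ∧
  Continuous M ∧
  (∀ ξ, HasDerivAt S (gam / v * (f (S ξ) * M ξ)) ξ) ∧
  (∀ ξ, 0 < M ξ → ∃ M' : ℝ, HasDerivAt M M' ξ ∧
    D (M ξ) * M' = v / gam * ((1 - S ξ - lam * F (S ξ)) - gam * M ξ)) ∧
  (∀ ξ, 0 ≤ ξ → M ξ = 0 ∧ S ξ = 1) ∧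
  Filter.Tendsto M Filter.atBot (nhds 0) ∧
  Filter.Tendsto S Filter.atBot (nhds sInf)

section TWHelpers
open Set Filter Topology

theorem cmp_le {φ φ' : ℝ → ℝ} {p q : ℝ} (hc : ContinuousOn φ (Icc p q))
    (hd : ∀ x ∈ Ioo p q, HasDerivAt φ (φ' x) x) (h0 : φ p ≤ 0)
    (hn : ∀ x ∈ Ioo p q, 0 < φ x → φ' x ≤ 0) : ∀ x ∈ Icc p q, φ x ≤ 0 := by
  intro x hx
  by_contra hpos
  push Not at hpos
  set T : Set ℝ := {y ∈ Icc p x | φ y ≤ 0} with hT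
  have hcx : ContinuousOn φ (Icc p x) := hc.mono (Icc_subset_Icc_right hx.2)
  have hTc : IsClosed T := by
    have := hcx.preimage_isClosed_of_isClosed isClosed_Icc (isClosed_Iic (a := (0:ℝ)))
    exact this
  have hTne : T.Nonempty := ⟨p, ⟨le_refl _, hx.1⟩, h0⟩
  have hTb : BddAbove T := ⟨x, fun y hy => hy.1.2⟩
  have hr := hTc.csSup_mem hTne hTb
  set r := sSup T
  have hrx : r < x := lt_of_le_of_ne hr.1.2 (fun h => by have := hr.2; rw [h] at this; linarith)
  have hpos' : ∀ y ∈ Ioo r x, 0 < φ y := by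
    intro y hy
    by_contra hle
    push Not at hle
    have : y ≤ r := le_csSup hTb ⟨⟨hr.1.1.trans hy.1.le, hy.2.le⟩, hle⟩
    linarith [hy.1]
  have hanti : AntitoneOn φ (Icc r x) := by
    apply antitoneOn_of_deriv_nonpos (convex_Icc r x)
    · exact hcx.mono (Icc_subset_Icc_left hr.1.1)
    · rw [interior_Icc]
      intro y hy
      exact (hd y ⟨lt_of_le_of_lt hr.1.1 hy.1, lt_of_lt_of_le hy.2 hx.2⟩).differentiableAt.differentiableWithinAt
    · rw [interior_Icc]
      intro y hy
      have hy' : y ∈ Ioo p q := ⟨lt_of_le_of_lt hr.1.1 hy.1, lt_of_lt_of_le hy.2 hx.2⟩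
      rw [(hd y hy').deriv]
      exact hn y hy' (hpos' y hy)
  have := hanti ⟨le_refl _, hrx.le⟩ ⟨hrx.le, le_refl _⟩ hrx.le
  linarith [hr.2]

theorem anti_of {φ φ' : ℝ → ℝ} {p q : ℝ} (hc : ContinuousOn φ (Icc p q))
    (hd : ∀ x ∈ Ioo p q, HasDerivAt φ (φ' x) x) 
    (hn : ∀ x ∈ Ioo p q, φ' x ≤ 0) : AntitoneOn φ (Icc p q) := by
  apply antitoneOn_of_deriv_nonpos (convex_Icc p q) hc
  · rw [interior_Icc]
    intro y hy
    exact (hd y hy).differentiableAt.differentiableWithinAt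
  · rw [interior_Icc]
    intro y hy
    rw [(hd y hy).deriv]
    exact hn y hy

structure MuData (D μ Φ : ℝ → ℝ) : Prop where
  mono : Monotone μ
  nonneg : ∀ u, 0 ≤ μ u
  lt_one : ∀ u, μ u < 1
  zero : ∀ u ≤ 0, μ u = 0
  phi_mu : ∀ u, 0 ≤ u → Φ (μ u) = u
  mu_phi : ∀ m ∈ Ico (0:ℝ) 1, μ (Φ m) = m
  phi_mono : StrictMonoOn Φ (Ico (0:ℝ) 1)
  phi_zero : Φ 0 = 0
  phi_deriv : ∀ m ∈ Ioo (0:ℝ) 1, HasDerivAt Φ (D m * m) m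
  phi_cont : ContinuousOn Φ (Ico (0:ℝ) 1)
  sub : ∀ x y, |μ x - μ y| ≤ μ |x - y|
  deriv : ∀ u, 0 < u → HasDerivAt μ (1 / (D (μ u) * μ u)) u
  cont : Continuous μ
  pos : ∀ u, 0 < u → 0 < μ u
  lip : ∀ ε > 0, ∃ K, 0 ≤ K ∧ ∀ x y, ε ≤ x → ε ≤ y → |μ x - μ y| ≤ K * |x - y|

theorem prim_facts {E : ℝ → ℝ} (hE : ContinuousOn E (Ico (0:ℝ) 1)) :
    ContinuousOn (fun m => ∫ x in (0:ℝ)..m, E x) (Ico (0:ℝ) 1) ∧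
    ∀ m ∈ Ioo (0:ℝ) 1, HasDerivAt (fun m => ∫ x in (0:ℝ)..m, E x) (E m) m := by
  have hint : ∀ m ∈ Ico (0:ℝ) 1, IntervalIntegrable E MeasureTheory.volume 0 m := by
    intro m hm
    apply ContinuousOn.intervalIntegrable
    rw [uIcc_of_le hm.1]
    exact hE.mono (fun x hx => ⟨hx.1, lt_of_le_of_lt hx.2 hm.2⟩)
  constructor
  · intro m hm
    obtain ⟨r, hr1, hr2⟩ := exists_between hm.2
    have hr0 : 0 ≤ r := hm.1.trans hr1.le
    have h1 := intervalIntegral.continuousOn_primitive_interval' (μ := MeasureTheory.volume)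
      (hint r ⟨hr0, hr2⟩) (left_mem_uIcc)
    rw [uIcc_of_le hr0] at h1
    have h2 := h1 m ⟨hm.1, hr1.le⟩
    refine h2.mono_of_mem_nhdsWithin ?_
    have : Iio r ∈ 𝓝 m := Iio_mem_nhds hr1
    filter_upwards [mem_nhdsWithin_of_mem_nhds this, self_mem_nhdsWithin] with x hx hx2
    exact ⟨hx2.1, le_of_lt hx⟩
  · intro m hm
    have hnhds : Ico (0:ℝ) 1 ∈ 𝓝 m := Ico_mem_nhds hm.1 hm.2
    refine intervalIntegral.integral_hasDerivAt_right (hint m ⟨hm.1.le, hm.2⟩) ?_ (hE.continuousAt hnhds)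
    exact hE.stronglyMeasurableAtFilter_nhdsWithin measurableSet_Ico m |>.filter_mono (by
      rw [nhdsWithin_eq_nhds.2 hnhds])

theorem exists_mu {D : ℝ → ℝ} (hDc : ContinuousOn D (Ico (0:ℝ) 1))
    (hDm : MonotoneOn D (Ico (0:ℝ) 1)) (hDp : ∀ m ∈ Ioo (0:ℝ) 1, 0 < D m)
    (hdiv : ∀ R : ℝ, ∃ m ∈ Ico (0:ℝ) 1, R ≤ ∫ x in (0:ℝ)..m, D x * x) :
    ∃ μ Φ, MuData D μ Φ := by
  set Φ : ℝ → ℝ := fun m => ∫ x in (0:ℝ)..m, D x * x with hΦ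
  obtain ⟨hΦc, hΦd⟩ := prim_facts (E := fun x => D x * x) (hDc.mul continuousOn_id)
  have hΦ0 : Φ 0 = 0 := by simp [hΦ]
  have hΦm : StrictMonoOn Φ (Ico (0:ℝ) 1) := by
    apply strictMonoOn_of_deriv_pos (convex_Ico 0 1) hΦc
    rw [interior_Ico]
    intro x hx
    rw [(hΦd x hx).deriv]
    exact mul_pos (hDp x hx) hx.1
  have hEm : ∀ x y, 0 < x → x ≤ y → y < 1 → D x * x ≤ D y * y := by
    intro x y hx hxy hy
    exact mul_le_mul (hDm ⟨hx.le, hxy.trans_lt hy⟩ ⟨(hx.trans_le hxy).le, hy⟩ hxy) hxy hx.le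
      (hDp y ⟨hx.trans_le hxy, hy⟩).le
  have hsurj : ∀ u, 0 ≤ u → ∃ m ∈ Ico (0:ℝ) 1, Φ m = u := by
    intro u hu
    obtain ⟨m, hm, hmu⟩ := hdiv u
    have := intermediate_value_Icc hm.1 (hΦc.mono (fun x hx => ⟨hx.1, hx.2.trans_lt hm.2⟩))
    obtain ⟨x, hx, hx2⟩ := this (show u ∈ Icc (Φ 0) (Φ m) by rw [hΦ0]; exact ⟨hu, hmu⟩)
    exact ⟨x, ⟨hx.1, hx.2.trans_lt hm.2⟩, hx2⟩
  have hex : ∀ u : ℝ, ∃ m ∈ Ico (0:ℝ) 1, Φ m = max u 0 := fun u => hsurj _ (le_max_right _ _)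
  choose μ hμ1 hμ2 using hex
  have mu_phi : ∀ m ∈ Ico (0:ℝ) 1, μ (Φ m) = m := by
    intro m hm
    apply hΦm.injOn (hμ1 _) hm
    rw [hμ2, max_eq_left]
    rw [← hΦ0]
    exact hΦm.monotoneOn ⟨le_refl _, zero_lt_one⟩ hm hm.1
  have phi_mu : ∀ u, 0 ≤ u → Φ (μ u) = u := fun u hu => by rw [hμ2, max_eq_left hu]
  have mono : Monotone μ := by
    intro x y hxy
    by_contra hlt
    push Not at hlt
    have := hΦm (hμ1 y) (hμ1 x) hlt
    rw [hμ2, hμ2] at this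
    have := max_le_max_right 0 hxy
    linarith
  have zero : ∀ u ≤ 0, μ u = 0 := by
    intro u hu
    apply hΦm.injOn (hμ1 _) ⟨le_refl _, zero_lt_one⟩
    rw [hμ2, hΦ0, max_eq_right hu]
  have pos : ∀ u, 0 < u → 0 < μ u := by
    intro u hu
    refine lt_of_le_of_ne (hμ1 u).1 (fun h => ?_)
    have := phi_mu u hu.le
    rw [← h, hΦ0] at this
    linarith
  -- superadditivity of Φ
  have super : ∀ m d, 0 ≤ m → 0 ≤ d → m + d < 1 → Φ d ≤ Φ (m + d) - Φ m := by
    intro m d hm hd hmd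
    have key : AntitoneOn (fun x => Φ x - Φ (m + x)) (Icc 0 d) := by
      apply anti_of (φ' := fun x => D x * x - D (m + x) * (m + x))
      · apply ContinuousOn.sub
        · exact hΦc.mono (fun x hx => ⟨hx.1, by linarith [hx.2]⟩)
        · exact hΦc.comp (by fun_prop) (fun x hx => ⟨by linarith [hx.1], by linarith [hx.2]⟩)
      · intro x hx
        have h1 := hΦd x ⟨hx.1, by linarith [hx.2]⟩
        have h2 := hΦd (m + x) ⟨by linarith [hx.1], by linarith [hx.2]⟩
        exact h1.sub (h2.comp_const_add m x)
      · intro x hx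
        have := hEm x (m + x) hx.1 (by linarith) (by linarith [hx.2])
        linarith
    have := key ⟨le_refl _, hd⟩ ⟨hd, le_refl _⟩ hd
    simp only [hΦ0, add_zero] at this
    linarith
  have sub0 : ∀ x y, x ≤ y → μ y - μ x ≤ μ (y - x) := by
    intro x y hxy
    have hd0 : 0 ≤ μ y - μ x := by linarith [mono hxy]
    have hd1 : μ y - μ x < 1 := by linarith [(hμ1 y).2, (hμ1 x).1]
    have h := super (μ x) (μ y - μ x) (hμ1 x).1 hd0 (by linarith [(hμ1 y).2])
    rw [show μ x + (μ y - μ x) = μ y by ring, hμ2, hμ2] at h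
    have h3 : Φ (μ y - μ x) ≤ y - x := by
      refine h.trans ?_
      rcases le_total 0 x with h0 | h0
      · rw [max_eq_left h0, max_eq_left (h0.trans hxy)]
      · rw [max_eq_right h0]
        have : max y 0 ≤ y - x := max_le (by linarith) (by linarith)
        linarith
    calc μ y - μ x = μ (Φ (μ y - μ x)) := (mu_phi _ ⟨hd0, hd1⟩).symm
      _ ≤ _ := mono h3
  have sub : ∀ x y, |μ x - μ y| ≤ μ |x - y| := by
    intro x y
    rcases le_total x y with h | h
    · rw [abs_sub_comm, abs_of_nonneg (by linarith [mono h]), abs_sub_comm x y, abs_of_nonneg (by linarith)]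
      exact sub0 x y h
    · rw [abs_of_nonneg (by linarith [mono h]), abs_of_nonneg (by linarith)]
      exact sub0 y x h
  have cont : ∀ u, ContinuousAt μ u := by
    intro u
    rw [Metric.continuousAt_iff]
    intro ε hε
    set e := min ε (1/2) / 2 with he
    have he0 : 0 < e := by positivity
    have he1 : e < 1 := by have := min_le_right ε (1/2); linarith
    have he2 : e < ε := by have := min_le_left ε (1/2); linarith
    refine ⟨Φ e, ?_, ?_⟩
    · rw [← hΦ0]; exact hΦm ⟨le_refl _, zero_lt_one⟩ ⟨he0.le, he1⟩ he0
    · intro x hx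
      rw [Real.dist_eq] at hx ⊢
      calc _ ≤ μ |x - u| := sub x u
        _ ≤ μ (Φ e) := mono hx.le
        _ = e := mu_phi e ⟨he0.le, he1⟩
        _ < ε := he2
  have hder : ∀ u, 0 < u → HasDerivAt μ (1 / (D (μ u) * μ u)) u := by
    intro u hu
    have hm : μ u ∈ Ioo (0:ℝ) 1 := ⟨pos u hu, (hμ1 u).2⟩
    rw [one_div]
    apply HasDerivAt.of_local_left_inverse (cont u) (hΦd (μ u) hm)
      (mul_pos (hDp _ hm) hm.1).ne'
    filter_upwards [lt_mem_nhds hu] with y hy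
    exact phi_mu y hy.le
  refine ⟨μ, Φ, mono, fun u => (hμ1 u).1, fun u => (hμ1 u).2, zero, phi_mu, mu_phi, hΦm, hΦ0,
    hΦd, hΦc, sub, hder, continuous_iff_continuousAt.2 cont, pos, ?_⟩
  intro ε hε
  have hmε : μ ε ∈ Ioo (0:ℝ) 1 := ⟨pos ε hε, (hμ1 ε).2⟩
  have hpε := mul_pos (hDp _ hmε) hmε.1
  refine ⟨1 / (D (μ ε) * μ ε), by positivity, ?_⟩
  intro x y hx hy
  have key := (convex_Ici ε).norm_image_sub_le_of_norm_hasDerivWithin_le (f := μ)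
    (f' := fun u => 1 / (D (μ u) * μ u)) (C := 1 / (D (μ ε) * μ ε))
    (fun x hx => (hder x (hε.trans_le hx)).hasDerivWithinAt) (by
      intro x hx
      have h1 := hEm (μ ε) (μ x) hmε.1 (mono hx) (hμ1 x).2
      rw [Real.norm_eq_abs, abs_of_nonneg (by
        have := hpε.trans_le h1
        positivity)]
      exact one_div_le_one_div_of_le hpε h1) (show y ∈ Ici ε from hy) (show x ∈ Ici ε from hx)
  have := key
  simpa [Real.norm_eq_abs] using this

theorem ode_approx {D μ Φ : ℝ → ℝ} (H : MuData D μ Φ) {p q : ℝ} (hpq : p < q) {A B : ℝ → ℝ}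
    (hA : ContinuousOn A (Icc p q)) (hB : ContinuousOn B (Icc p q)) {c : ℝ} (hc : 0 < c)
    {ε : ℝ} (hε : 0 < ε) :
    ∃ w : ℝ → ℝ, ContinuousOn w (Icc p q) ∧ w p = 0 ∧
      ∀ s ∈ Ioo p q, HasDerivAt w (A s - B s * (μ (max (c * w s) 0 + ε) - μ ε)) s := by
  obtain ⟨Am, hAm⟩ := isCompact_Icc.exists_bound_of_continuousOn hA
  obtain ⟨Bm, hBm⟩ := isCompact_Icc.exists_bound_of_continuousOn hB
  have hp : p ∈ Icc p q := ⟨le_refl _, hpq.le⟩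
  have hAm0 : 0 ≤ Am := (norm_nonneg _).trans (hAm p hp)
  have hBm0 : 0 ≤ Bm := (norm_nonneg _).trans (hBm p hp)
  obtain ⟨K, hK0, hK⟩ := H.lip ε hε
  have hPL : IsPicardLindelof (fun s x => A s - B s * (μ (max (c * x) 0 + ε) - μ ε))
      (⟨p, hp⟩ : Icc p q) (0:ℝ) (((Am + Bm) * (q - p)).toNNReal) 0 ((Am + Bm).toNNReal)
      ((Bm * (K * c)).toNNReal) := by
    constructor
    · intro t ht
      apply LipschitzOnWith.of_dist_le_mul
      intro x _ y _
      rw [Real.coe_toNNReal _ (by positivity), Real.dist_eq, Real.dist_eq]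
      have h1 : |μ (max (c * y) 0 + ε) - μ (max (c * x) 0 + ε)| ≤ K * (c * |x - y|) := by
        refine (hK _ _ (by linarith [le_max_right (c * y) 0]) (by linarith [le_max_right (c * x) 0])).trans ?_
        apply mul_le_mul_of_nonneg_left _ hK0
        rw [add_sub_add_right_eq_sub]
        refine (abs_max_sub_max_le_abs _ _ _).trans ?_
        rw [← mul_sub, abs_mul, abs_of_pos hc, abs_sub_comm]
      have h2 := hBm t ht
      rw [Real.norm_eq_abs] at h2
      calc _ = |B t| * |μ (max (c * y) 0 + ε) - μ (max (c * x) 0 + ε)| := by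
            rw [← abs_mul]; congr 1; ring
        _ ≤ Bm * (K * (c * |x - y|)) := mul_le_mul h2 h1 (abs_nonneg _) hBm0
        _ = _ := by ring
    · intro x _
      exact hA.sub (hB.mul continuousOn_const)
    · intro t ht x _
      rw [Real.coe_toNNReal _ (by positivity)]
      have h0 : |μ (max (c * x) 0 + ε) - μ ε| ≤ 1 := by
        rw [abs_le]
        constructor <;> linarith [H.nonneg ε, H.nonneg (max (c * x) 0 + ε), H.lt_one ε, H.lt_one (max (c * x) 0 + ε)]
      refine (norm_sub_le _ _).trans ?_
      rw [norm_mul]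
      have := mul_le_mul (hBm t ht) h0 (abs_nonneg _) hBm0
      have h3 := hAm t ht
      simp only [Real.norm_eq_abs] at *
      linarith
    · simp only [NNReal.coe_zero, sub_zero, sub_self]
      rw [Real.coe_toNNReal _ (by positivity), Real.coe_toNNReal _ (mul_nonneg (by positivity) (by linarith)),
        max_eq_left (by linarith)]
  obtain ⟨w, hw0, hw⟩ := hPL.exists_eq_forall_mem_Icc_hasDerivWithinAt₀
  refine ⟨w, fun s hs => (hw s hs).continuousWithinAt, hw0, fun s hs => ?_⟩
  exact (hw s ⟨hs.1.le, hs.2.le⟩).hasDerivAt (Icc_mem_nhds hs.1 hs.2)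

theorem ode_exists {D μ Φ : ℝ → ℝ} (H : MuData D μ Φ) {p q : ℝ} (hpq : p < q) {A B : ℝ → ℝ}
    (hA : ContinuousOn A (Icc p q)) (hB : ContinuousOn B (Icc p q))
    (hB0 : ∀ s ∈ Icc p q, 0 ≤ B s) {c : ℝ} (hc : 0 < c) :
    ∃ w : ℝ → ℝ, ContinuousOn w (Icc p q) ∧ w p = 0 ∧
      ∀ s ∈ Ioo p q, HasDerivAt w (A s - B s * μ (c * w s)) s := by
  obtain ⟨Bm, hBm⟩ := isCompact_Icc.exists_bound_of_continuousOn hB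
  have hp : p ∈ Icc p q := ⟨le_refl _, hpq.le⟩
  have hBm0 : 0 ≤ Bm := (norm_nonneg _).trans (hBm p hp)
  have hBm' : ∀ s ∈ Icc p q, B s ≤ Bm := fun s hs => (le_abs_self _).trans (hBm s hs)
  let g : ℕ → ℝ → ℝ := fun n x => μ (max (c * x) 0 + 1 / ((n:ℝ) + 1)) - μ (1 / ((n:ℝ) + 1))
  let e : ℕ → ℝ := fun n => μ (1 / ((n:ℝ) + 1))
  have he0 : ∀ n, 0 ≤ e n := fun n => H.nonneg _
  have hmx : ∀ x, μ (c * x) = μ (max (c * x) 0) := by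
    intro x
    rcases le_total 0 (c * x) with h | h
    · rw [max_eq_left h]
    · rw [max_eq_right h, H.zero _ h, H.zero _ le_rfl]
  have hg : ∀ n x, |g n x - μ (c * x)| ≤ e n := by
    intro n x
    have hn : 0 < 1 / ((n:ℝ) + 1) := by positivity
    have h1 := H.sub (max (c * x) 0 + 1 / ((n:ℝ) + 1)) (max (c * x) 0)
    have h2 := H.mono (show max (c * x) 0 ≤ max (c * x) 0 + 1 / ((n:ℝ) + 1) by linarith)
    rw [add_sub_cancel_left, abs_of_pos hn, abs_of_nonneg (by linarith)] at h1
    simp only [g, e]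
    rw [hmx, abs_le]
    constructor <;> linarith [H.nonneg (1 / ((n:ℝ) + 1))]
  have hex : ∀ n : ℕ, ∃ w : ℝ → ℝ, ContinuousOn w (Icc p q) ∧ w p = 0 ∧
      ∀ s ∈ Ioo p q, HasDerivAt w (A s - B s * g n (w s)) s := fun n =>
    ode_approx H hpq hA hB hc (by positivity)
  choose W hWc hW0 hWd using hex
  have hmono : ∀ x y, x < y → μ (c * x) ≤ μ (c * y) := fun x y hxy =>
    H.mono (mul_le_mul_of_nonneg_left hxy.le hc.le)
  have hCau : ∀ n k, ∀ s ∈ Icc p q, W n s - W k s ≤ Bm * (e n + e k) * (q - p) := by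
    intro n k s hs
    have := cmp_le (φ := fun s => W n s - W k s - Bm * (e n + e k) * (s - p)) (p := p) (q := q)
      (φ' := fun s => (A s - B s * g n (W n s)) - (A s - B s * g k (W k s)) - Bm * (e n + e k) * 1)
      (((hWc n).sub (hWc k)).sub (by fun_prop))
      (fun x hx => ((hWd n x hx).sub (hWd k x hx)).sub
        (((hasDerivAt_id x).sub_const p).const_mul _)) (by simp [hW0]) (by
        intro x hx hpos
        have hx' : x ∈ Icc p q := ⟨hx.1.le, hx.2.le⟩
        have h0 : 0 ≤ Bm * (e n + e k) * (x - p) :=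
          mul_nonneg (mul_nonneg hBm0 (add_nonneg (he0 n) (he0 k))) (by linarith [hx.1])
        have h1 := hmono (W k x) (W n x) (by linarith)
        have h2 := abs_le.1 (hg n (W n x))
        have h3 := abs_le.1 (hg k (W k x))
        have h4 : g k (W k x) - g n (W n x) ≤ e n + e k := by linarith [h2.1, h3.2]
        have h5 : B x * (g k (W k x) - g n (W n x)) ≤ B x * (e n + e k) :=
          mul_le_mul_of_nonneg_left h4 (hB0 x hx')
        have h6 : B x * (e n + e k) ≤ Bm * (e n + e k) :=
          mul_le_mul_of_nonneg_right (hBm' x hx') (add_nonneg (he0 n) (he0 k))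
        nlinarith) s hs
    have h7 : Bm * (e n + e k) * (s - p) ≤ Bm * (e n + e k) * (q - p) :=
      mul_le_mul_of_nonneg_left (by linarith [hs.2]) (mul_nonneg hBm0 (add_nonneg (he0 n) (he0 k)))
    linarith
  have helim : Tendsto e atTop (𝓝 0) := by
    have h1 := tendsto_one_div_add_atTop_nhds_zero_nat (𝕜 := ℝ)
    have h2 := (H.cont.tendsto 0).comp h1
    rw [H.zero 0 le_rfl] at h2
    exact h2
  have hCabs : ∀ n k, ∀ s ∈ Icc p q, |W n s - W k s| ≤ Bm * (e n + e k) * (q - p) := by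
    intro n k s hs
    rw [abs_le]
    have h1 := hCau n k s hs
    have h2 := hCau k n s hs
    rw [add_comm (e k)] at h2
    constructor <;> linarith
  have hconv : ∀ s ∈ Icc p q, ∃ l, Tendsto (fun n => W n s) atTop (𝓝 l) := by
    intro s hs
    apply cauchySeq_tendsto_of_complete
    rw [Metric.cauchySeq_iff']
    intro ε hε
    have h1 : Tendsto (fun n => Bm * (e n + e n) * (q - p)) atTop (𝓝 (Bm * (0 + 0) * (q - p))) :=
      ((helim.add helim).const_mul Bm).mul_const _
    have h2 : Tendsto (fun n => Bm * (q - p) * e n) atTop (𝓝 (Bm * (q - p) * 0)) := helim.const_mul _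
    rw [mul_zero] at h2
    obtain ⟨N, hN⟩ := eventually_atTop.1 (h2.eventually (gt_mem_nhds (show 0 < ε / 2 by linarith)))
    refine ⟨N, fun n hn => ?_⟩
    rw [Real.dist_eq]
    have := hCabs n N s hs
    have a1 := hN n hn
    have a2 := hN N le_rfl
    nlinarith
  have hconv' : ∀ s, ∃ l, s ∈ Icc p q → Tendsto (fun n => W n s) atTop (𝓝 l) := by
    intro s
    by_cases hs : s ∈ Icc p q
    · obtain ⟨l, hl⟩ := hconv s hs
      exact ⟨l, fun _ => hl⟩
    · exact ⟨0, fun h => absurd h hs⟩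
  choose w hw using hconv'
  have hbd : ∀ n, ∀ s ∈ Icc p q, |W n s - w s| ≤ Bm * (q - p) * e n := by
    intro n s hs
    have h1 : Tendsto (fun k => |W n s - W k s|) atTop (𝓝 |W n s - w s|) :=
      ((hw s hs).const_sub _).abs
    have h2 : Tendsto (fun k => Bm * (e n + e k) * (q - p)) atTop (𝓝 (Bm * (e n + 0) * (q - p))) :=
      ((helim.const_add _).const_mul Bm).mul_const _
    have := le_of_tendsto_of_tendsto' h1 h2 (fun k => hCabs n k s hs)
    calc _ ≤ _ := this
      _ = _ := by ring
  have hblim : Tendsto (fun n => Bm * (q - p) * e n) atTop (𝓝 0) := by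
    simpa using helim.const_mul (Bm * (q - p))
  have hunif : TendstoUniformlyOn W w atTop (Icc p q) := by
    rw [Metric.tendstoUniformlyOn_iff]
    intro ε hε
    filter_upwards [hblim.eventually (gt_mem_nhds hε)] with n hn s hs
    rw [dist_comm, Real.dist_eq]
    exact (hbd n s hs).trans_lt hn
  refine ⟨w, hunif.continuousOn (Frequently.of_forall hWc), ?_, ?_⟩
  · have := hw p hp
    simp only [hW0] at this
    exact (tendsto_nhds_unique this tendsto_const_nhds)
  · intro s hs
    apply hasDerivAt_of_tendstoUniformlyOn (l := atTop) (f := W) (s := Ioo p q)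
      (f' := fun n s => A s - B s * g n (W n s)) (g' := fun s => A s - B s * μ (c * w s)) isOpen_Ioo _
      (Eventually.of_forall hWd) (fun x hx => hw x ⟨hx.1.le, hx.2.le⟩) hs
    rw [Metric.tendstoUniformlyOn_iff]
    intro ε hε
    have h1 : Tendsto (fun n => Bm * (e n + μ (c * (Bm * (q - p) * e n)))) atTop (𝓝 (Bm * (0 + 0))) := by
      apply Tendsto.const_mul
      apply helim.add
      have h2 := (H.cont.tendsto 0).comp (show Tendsto (fun n => c * (Bm * (q - p) * e n)) atTop (𝓝 0) by
        simpa using hblim.const_mul c)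
      rw [H.zero 0 le_rfl] at h2
      exact h2
    simp only [add_zero, mul_zero] at h1
    filter_upwards [h1.eventually (gt_mem_nhds hε)] with n hn x hx
    have hx' : x ∈ Icc p q := ⟨hx.1.le, hx.2.le⟩
    rw [Real.dist_eq]
    refine lt_of_le_of_lt ?_ hn
    have h3 : |g n (W n x) - μ (c * w x)| ≤ e n + μ (c * (Bm * (q - p) * e n)) := by
      have h4 := hg n (W n x)
      have h5 := H.sub (c * W n x) (c * w x)
      have h6 : μ |c * W n x - c * w x| ≤ μ (c * (Bm * (q - p) * e n)) := by
        apply H.mono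
        rw [← mul_sub, abs_mul, abs_of_pos hc]
        exact mul_le_mul_of_nonneg_left (hbd n x hx') hc.le
      calc _ ≤ |g n (W n x) - μ (c * W n x)| + |μ (c * W n x) - μ (c * w x)| := abs_sub_le _ _ _
        _ ≤ _ := by linarith
    calc _ = |B x| * |g n (W n x) - μ (c * w x)| := by
          rw [← abs_mul]; congr 1; ring
      _ ≤ _ := mul_le_mul (hBm x hx') h3 (abs_nonneg _) hBm0

structure HData (p sM gam : ℝ) (f h h' G : ℝ → ℝ) : Prop where
  p_pos : 0 < p
  p_lt : p < 1
  gam_pos : 0 < gam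
  f_cont : ContinuousOn f (Icc p 1)
  f_pos : ∀ s ∈ Icc p 1, 0 < f s
  f_le : ∀ s ∈ Icc p 1, f s ≤ 1
  h_cont : ContinuousOn h (Icc p 1)
  h_p : h p = 0
  h_one : h 1 = 0
  h_pos : ∀ s ∈ Ioo p 1, 0 < h s
  h_le : ∃ C0 > 0, ∀ s ∈ Icc p 1, h s ≤ C0 * (1 - s)
  G_cont : ContinuousOn G (Icc p 1)
  G_deriv : ∀ s ∈ Ioo p 1, HasDerivAt G ((h s - gam) / f s) s
  G_one : G 1 = 0
  G_pos : ∀ s ∈ Ico p 1, 0 < G s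
  sM_mem : sM ∈ Ioo p 1
  h_deriv : ∀ s ∈ Ioo p 1, HasDerivAt h (h' s) s
  h_up : ∀ s ∈ Ioo p 1, s ≤ sM → 0 ≤ h' s
  h_down : ∀ s ∈ Ioo p 1, sM ≤ s → h' s ≤ 0
  h_sM : gam < h sM

def Sol (p gam : ℝ) (f h μ : ℝ → ℝ) (c : ℝ) (w : ℝ → ℝ) : Prop :=
  ContinuousOn w (Icc p 1) ∧ w p = 0 ∧
    ∀ s ∈ Ioo p 1, HasDerivAt w ((h s - gam * μ (c * w s)) / f s) s

section
variable {p sM gam : ℝ} {f h h' G D μ Φ : ℝ → ℝ}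

theorem sol_exists (X : HData p sM gam f h h' G) (H : MuData D μ Φ) {c : ℝ} (hc : 0 < c) :
    ∃ w, Sol p gam f h μ c w := by
  have hf : ∀ s ∈ Icc p 1, f s ≠ 0 := fun s hs => (X.f_pos s hs).ne'
  obtain ⟨w, h1, h2, h3⟩ := ode_exists H X.p_lt (A := fun s => h s / f s) (B := fun s => gam / f s)
    (X.h_cont.div X.f_cont hf) (continuousOn_const.div X.f_cont hf)
    (fun s hs => (div_pos X.gam_pos (X.f_pos s hs)).le) hc
  refine ⟨w, h1, h2, fun s hs => ?_⟩
  have := h3 s hs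
  convert this using 1
  ring

theorem sol_nonneg (X : HData p sM gam f h h' G) (H : MuData D μ Φ) {c : ℝ} (hc : 0 < c)
    {w : ℝ → ℝ} (hw : Sol p gam f h μ c w) : ∀ s ∈ Icc p 1, 0 ≤ w s := by
  intro s hs
  have := cmp_le (φ := fun s => - w s) hw.1.neg (fun x hx => (hw.2.2 x hx).neg) (by simp [hw.2.1]) (by
    intro x hx hpos
    have h1 : c * w x ≤ 0 := by nlinarith
    rw [H.zero _ h1]
    have := div_pos (X.h_pos x hx) (X.f_pos x ⟨hx.1.le, hx.2.le⟩)
    simp only [mul_zero, sub_zero]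
    linarith) s hs
  linarith

theorem sol_pos (X : HData p sM gam f h h' G) (H : MuData D μ Φ) {c : ℝ} (hc : 0 < c)
    {w : ℝ → ℝ} (hw : Sol p gam f h μ c w) : ∀ s ∈ Ioo p 1, 0 < w s := by
  intro s hs
  have hs' : s ∈ Icc p 1 := ⟨hs.1.le, hs.2.le⟩
  refine lt_of_le_of_ne (sol_nonneg X H hc hw s hs') (fun h0 => ?_)
  have hmin : IsLocalMin w s := by
    filter_upwards [Icc_mem_nhds hs.1 hs.2] with y hy
    rw [← h0]
    exact sol_nonneg X H hc hw y hy
  have := hmin.hasDerivAt_eq_zero (hw.2.2 s hs)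
  rw [← h0, mul_zero, H.zero 0 le_rfl, mul_zero, sub_zero] at this
  have := div_pos (X.h_pos s hs) (X.f_pos s hs')
  linarith

theorem sol_mono (X : HData p sM gam f h h' G) (H : MuData D μ Φ) {c c' : ℝ} (hc : 0 < c) (hcc : c ≤ c')
    {w w' : ℝ → ℝ} (hw : Sol p gam f h μ c w) (hw' : Sol p gam f h μ c' w') :
    ∀ s ∈ Icc p 1, w' s ≤ w s := by
  intro s hs
  have := cmp_le (φ := fun s => w' s - w s) (hw'.1.sub hw.1)
    (fun x hx => (hw'.2.2 x hx).sub (hw.2.2 x hx)) (by simp [hw.2.1, hw'.2.1]) (by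
    intro x hx hpos
    have hx' : x ∈ Icc p 1 := ⟨hx.1.le, hx.2.le⟩
    have h1 := sol_nonneg X H hc hw x hx'
    have h2 : μ (c * w x) ≤ μ (c' * w' x) := H.mono (by
      apply mul_le_mul hcc (by linarith) h1 (by linarith))
    rw [← sub_div]
    apply div_nonpos_of_nonpos_of_nonneg _ (X.f_pos x hx').le
    have := mul_le_mul_of_nonneg_left h2 X.gam_pos.le
    linarith) s hs
  linarith

theorem sol_bounds (X : HData p sM gam f h h' G) (H : MuData D μ Φ) :
    ∃ Wm K0 : ℝ, 0 < Wm ∧ 0 < K0 ∧ (∀ s ∈ Icc p 1, gam / f s ≤ K0) ∧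
    (∀ c w, 0 < c → Sol p gam f h μ c w → ∀ s ∈ Icc p 1, w s ≤ Wm) ∧
    (∀ c w c' w', 0 < c → c ≤ c' → Sol p gam f h μ c w → Sol p gam f h μ c' w' →
      ∀ s ∈ Icc p 1, w s ≤ w' s + K0 * μ ((c' - c) * Wm)) := by
  have hf : ∀ s ∈ Icc p 1, f s ≠ 0 := fun s hs => (X.f_pos s hs).ne'
  obtain ⟨K, hK⟩ := isCompact_Icc.exists_bound_of_continuousOn
    ((continuousOn_const (c := gam)).div X.f_cont hf)
  obtain ⟨L, hL⟩ := isCompact_Icc.exists_bound_of_continuousOn (X.h_cont.div X.f_cont hf)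
  have hp : p ∈ Icc p 1 := ⟨le_refl _, X.p_lt.le⟩
  have hL0 : 0 ≤ L := (norm_nonneg _).trans (hL p hp)
  have hK0 : 0 ≤ K := (norm_nonneg _).trans (hK p hp)
  have hK' : ∀ s ∈ Icc p 1, gam / f s ≤ K + 1 := fun s hs => by
    have := (le_abs_self _).trans (hK s hs)
    simp only [Pi.div_apply] at this
    linarith
  have hL' : ∀ s ∈ Icc p 1, h s / f s ≤ L + 1 := fun s hs => by
    have := (le_abs_self _).trans (hL s hs)
    simp only [Pi.div_apply] at this
    linarith
  have hW : ∀ c w, 0 < c → Sol p gam f h μ c w → ∀ s ∈ Icc p 1, w s ≤ L + 1 := by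
    intro c w hc hw s hs
    have := cmp_le (φ := fun s => w s - (L + 1) * (s - p)) (hw.1.sub (by fun_prop))
      (fun x hx => (hw.2.2 x hx).sub (((hasDerivAt_id x).sub_const p).const_mul (L + 1)))
      (by simp [hw.2.1]) (by
      intro x hx hpos
      have hx' : x ∈ Icc p 1 := ⟨hx.1.le, hx.2.le⟩
      have h1 : (h x - gam * μ (c * w x)) / f x ≤ h x / f x := by
        apply div_le_div_of_nonneg_right _ (X.f_pos x hx').le
        have := mul_nonneg X.gam_pos.le (H.nonneg (c * w x))
        linarith
      have := hL' x hx'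
      linarith) s hs
    have h2 : (L + 1) * (s - p) ≤ (L + 1) * 1 :=
      mul_le_mul_of_nonneg_left (by linarith [hs.2, X.p_pos]) (by linarith)
    linarith
  refine ⟨L + 1, K + 1, by linarith, by linarith, hK', hW, ?_⟩
  intro c w c' w' hc hcc hw hw' s hs
  set e := μ ((c' - c) * (L + 1))
  have he : 0 ≤ e := H.nonneg _
  have := cmp_le (φ := fun s => w s - w' s - (K + 1) * e * (s - p)) ((hw.1.sub hw'.1).sub (by fun_prop))
      (fun x hx => ((hw.2.2 x hx).sub (hw'.2.2 x hx)).sub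
        (((hasDerivAt_id x).sub_const p).const_mul ((K + 1) * e)))
      (by simp [hw.2.1, hw'.2.1]) (by
      intro x hx hpos
      have hx' : x ∈ Icc p 1 := ⟨hx.1.le, hx.2.le⟩
      have hK1 : 0 ≤ (K + 1) * e * (x - p) :=
        mul_nonneg (mul_nonneg (by linarith) he) (by linarith [hx.1])
      have hww : w' x ≤ w x := by linarith
      have h0 := sol_nonneg X H hc hw x hx'
      have h1 : μ (c' * w' x) ≤ μ (c' * w x) := H.mono (mul_le_mul_of_nonneg_left hww (by linarith))
      have h2 : μ (c' * w x) - μ (c * w x) ≤ e := by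
        refine (le_abs_self _).trans ((H.sub _ _).trans (H.mono ?_))
        rw [← sub_mul, abs_of_nonneg (mul_nonneg (by linarith) h0)]
        exact mul_le_mul_of_nonneg_left (hW c w hc hw x hx') (by linarith)
      have h3 : (h x - gam * μ (c * w x)) / f x - (h x - gam * μ (c' * w' x)) / f x
          = gam / f x * (μ (c' * w' x) - μ (c * w x)) := by ring
      rw [h3]
      have h4 : gam / f x * (μ (c' * w' x) - μ (c * w x)) ≤ gam / f x * e :=
        mul_le_mul_of_nonneg_left (by linarith) (div_pos X.gam_pos (X.f_pos x hx')).le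
      have h5 : gam / f x * e ≤ (K + 1) * e := mul_le_mul_of_nonneg_right (hK' x hx') he
      linarith) s hs
  have h6 : (K + 1) * e * (s - p) ≤ (K + 1) * e * 1 :=
    mul_le_mul_of_nonneg_left (by linarith [hs.2, X.p_pos]) (mul_nonneg (by linarith) he)
  linarith

set_option maxHeartbeats 1000000 in
theorem sol_barrier (X : HData p sM gam f h h' G) (H : MuData D μ Φ) {a C1 m1 : ℝ} (ha : 1 < a)
    (hC1 : 0 < C1) (hm1 : 0 < m1) (hm1' : m1 < 1)
    (hD : ∀ m ∈ Ioo 0 m1, D m ≤ C1 * m ^ a) {cm : ℝ} (hcm : 0 < cm) :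
    ∃ δ q : ℝ, 0 < δ ∧ p < 1 - δ ∧ 0 < q ∧ ∀ c w, cm ≤ c → Sol p gam f h μ c w → 0 < w 1 →
      ∀ s ∈ Ioo (1 - δ) 1, q * (1 - s) ^ (1 / (a + 1)) ≤ μ (c * w s) ∧
        h s ≤ gam / 2 * (q * (1 - s) ^ (1 / (a + 1))) := by
  obtain ⟨C0, hC0, hh⟩ := X.h_le
  have hg := X.gam_pos
  set α := 1 / (a + 1) with hα
  have hα0 : 0 < α := by positivity
  have hα1 : α < 1 := by rw [hα, div_lt_one (by linarith)]; linarith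
  have haα : α * (a + 1) = 1 := by rw [hα]; field_simp
  set q := min (m1 / 2) (cm * gam / (2 * C1)) with hq
  have hq0 : 0 < q := by positivity
  have hqm : q ≤ m1 / 2 := min_le_left _ _
  have hqc : C1 * q ≤ cm * gam / 2 := by
    have : q ≤ cm * gam / (2 * C1) := min_le_right _ _
    rw [le_div_iff₀ (by positivity)] at this
    linarith
  have hlim : Tendsto (fun t : ℝ => t ^ (1 - α)) (𝓝 0) (𝓝 0) := by
    have := (Real.continuousAt_rpow_const 0 (1 - α) (Or.inr (by linarith))).tendsto
    rwa [Real.zero_rpow (by linarith)] at this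
  have hev := hlim.eventually (gt_mem_nhds (show 0 < gam * q / (2 * C0) by positivity))
  obtain ⟨δ0, hδ0, hδ⟩ := Metric.eventually_nhds_iff.1 hev
  have hp1 := X.p_lt
  have hp0 := X.p_pos
  set δ := min δ0 ((1 - p) / 2) with hδd
  have hδp : 0 < δ := lt_min hδ0 (by linarith)
  have hδ1 : δ ≤ (1 - p) / 2 := min_le_right _ _
  refine ⟨δ, q, hδp, by linarith, hq0, ?_⟩
  have hhb : ∀ s ∈ Ioo (1 - δ) 1, h s ≤ gam / 2 * (q * (1 - s) ^ α) := by
    intro s hs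
    have ht : 0 < 1 - s := by linarith [hs.2]
    have h1 := hδ (y := 1 - s) (by
      rw [Real.dist_eq, sub_zero, abs_of_pos ht]
      have := min_le_left δ0 ((1 - p) / 2)
      linarith [hs.1])
    rw [lt_div_iff₀ (by positivity)] at h1
    have h2 : (1 - s) = (1 - s) ^ (1 - α) * (1 - s) ^ α := by
      rw [← Real.rpow_add ht]; simp
    have h3 := hh s ⟨by linarith [hs.1], hs.2.le⟩
    have h4 : 0 < (1 - s) ^ α := Real.rpow_pos_of_pos ht _
    calc h s ≤ C0 * (1 - s) := h3
      _ = C0 * ((1 - s) ^ (1 - α) * (1 - s) ^ α) := by rw [← h2]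
      _ ≤ _ := by nlinarith
  intro c w hc hw hw1 s0 hs0
  refine ⟨?_, hhb s0 hs0⟩
  have hcp : 0 < c := hcm.trans_le hc
  have hmz : ∀ s ∈ Ioo (1 - δ) 1, q * (1 - s) ^ α ∈ Ioo 0 m1 := by
    intro s hs
    have ht : 0 < 1 - s := by linarith [hs.2]
    have h4 : 0 < (1 - s) ^ α := Real.rpow_pos_of_pos ht _
    have h5 : (1 - s) ^ α ≤ 1 := Real.rpow_le_one ht.le (by linarith [hs.1]) hα0.le
    exact ⟨by positivity, by nlinarith⟩
  by_contra hlt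
  push Not at hlt
  have hwlt : c * w s0 - Φ (q * (1 - s0) ^ α) ≤ 0 := by
    by_contra hcon
    push Not at hcon
    have h1 := H.mono (show Φ (q * (1 - s0) ^ α) ≤ c * w s0 by linarith)
    rw [H.mu_phi _ ⟨(hmz s0 hs0).1.le, (hmz s0 hs0).2.trans hm1'⟩] at h1
    linarith
  have := cmp_le (φ := fun s => c * w s - Φ (q * (1 - s) ^ α)) (p := s0) (q := 1)
    (φ' := fun s => c * ((h s - gam * μ (c * w s)) / f s) -
      D (q * (1 - s) ^ α) * (q * (1 - s) ^ α) * (q * ((-1) * α * (1 - s) ^ (α - 1))))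
    (by
      apply ContinuousOn.sub
      · exact continuousOn_const.mul (hw.1.mono (Icc_subset_Icc_left (by linarith [hs0.1])))
      · apply H.phi_cont.comp
        · apply ContinuousOn.mul continuousOn_const
          apply ContinuousOn.rpow_const (by fun_prop)
          intro x hx; right; exact hα0.le
        · intro x hx
          rcases hx.2.lt_or_eq with hx1 | hx1
          · have := hmz x ⟨by linarith [hs0.1, hx.1], hx1⟩
            exact ⟨this.1.le, this.2.trans hm1'⟩
          · show q * (1 - x) ^ α ∈ Ico (0:ℝ) 1
            rw [hx1, sub_self, Real.zero_rpow hα0.ne', mul_zero]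
            exact ⟨le_rfl, zero_lt_one⟩)
    (by
      intro x hx
      have hx' : x ∈ Ioo (1 - δ) 1 := ⟨hs0.1.trans hx.1, hx.2⟩
      have hm := hmz x hx'
      have d1 := (hw.2.2 x ⟨by linarith [hx'.1], hx.2⟩).const_mul c
      have d2 := H.phi_deriv _ ⟨hm.1, hm.2.trans hm1'⟩
      have d3 : HasDerivAt (fun s : ℝ => q * (1 - s) ^ α) (q * ((-1) * α * (1 - x) ^ (α - 1))) x := by
        apply HasDerivAt.const_mul
        exact ((hasDerivAt_id x).const_sub 1).rpow_const (Or.inl (by simp; linarith [hx.2]))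
      exact d1.sub (d2.comp x d3)) hwlt (by
      intro x hx hpos
      have hx' : x ∈ Ioo (1 - δ) 1 := ⟨hs0.1.trans hx.1, hx.2⟩
      have hxp : x ∈ Icc p 1 := ⟨by linarith [hx'.1], hx.2.le⟩
      have hm := hmz x hx'
      have hb := hhb x hx'
      have ht : 0 < 1 - x := by linarith [hx.2]
      have h1 := H.mono (show Φ (q * (1 - x) ^ α) ≤ c * w x by linarith)
      rw [H.mu_phi _ ⟨hm.1.le, hm.2.trans hm1'⟩] at h1
      have hDm := hD _ hm
      set mz := q * (1 - x) ^ α with hmzd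
      have hA : c * ((h x - gam * μ (c * w x)) / f x) ≤ - (cm * gam / 2 * mz) := by
        have e1 : h x - gam * μ (c * w x) ≤ - (gam / 2 * mz) := by nlinarith
        have hfx := X.f_pos x hxp
        have hfx1 := X.f_le x hxp
        have e2 : (h x - gam * μ (c * w x)) / f x ≤ - (gam / 2 * mz) := by
          rw [div_le_iff₀ hfx]
          have : gam / 2 * mz * f x ≤ gam / 2 * mz := by
            have : 0 < gam / 2 * mz := mul_pos (by linarith) hm.1
            nlinarith
          linarith
        have e3 : 0 < gam / 2 * mz := mul_pos (by linarith) hm.1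
        have e4 := mul_le_mul_of_nonneg_left e2 hcp.le
        have e5 := mul_le_mul_of_nonneg_right hc e3.le
        linarith
      have hB : D mz * (q * (α * (1 - x) ^ (α - 1))) ≤ cm * gam / 2 := by
        have hr : 0 < (1 - x) ^ (α - 1) := Real.rpow_pos_of_pos ht _
        have e1 : mz ^ a = q ^ a * (1 - x) ^ (α * a) := by
          rw [hmzd, Real.mul_rpow hq0.le (Real.rpow_pos_of_pos ht _).le, ← Real.rpow_mul ht.le]
        have e2 : (1 - x) ^ (α * a) * (1 - x) ^ (α - 1) = 1 := by
          rw [← Real.rpow_add ht, show α * a + (α - 1) = 0 by linarith, Real.rpow_zero]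
        have e3 : q ^ a ≤ 1 := Real.rpow_le_one hq0.le (by linarith) (by linarith)
        have e4 : 0 < q ^ a := Real.rpow_pos_of_pos hq0 _
        calc D mz * (q * (α * (1 - x) ^ (α - 1))) ≤ C1 * mz ^ a * (q * (α * (1 - x) ^ (α - 1))) :=
              mul_le_mul_of_nonneg_right hDm (by positivity)
          _ = (C1 * q) * (q ^ a * α) * ((1 - x) ^ (α * a) * (1 - x) ^ (α - 1)) := by rw [e1]; ring
          _ = (C1 * q) * (q ^ a * α) := by rw [e2, mul_one]
          _ ≤ (C1 * q) * 1 := by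
              apply mul_le_mul_of_nonneg_left _ (by positivity)
              nlinarith
          _ ≤ _ := by linarith
      have hB2 := mul_le_mul_of_nonneg_right hB hm.1.le
      have hB3 : D mz * mz * (q * ((-1) * α * (1 - x) ^ (α - 1)))
        = - (D mz * (q * (α * (1 - x) ^ (α - 1))) * mz) := by ring
      rw [hB3]
      linarith) 1 ⟨hs0.2.le, le_rfl⟩
  simp only [sub_self, Real.zero_rpow hα0.ne', mul_zero, H.phi_zero, sub_zero] at this
  have := mul_pos hcp hw1
  linarith
end

section
variable {p sM gam : ℝ} {f h h' G D μ Φ : ℝ → ℝ}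

theorem sol_small (X : HData p sM gam f h h' G) (H : MuData D μ Φ) :
    ∃ c > 0, ∀ w, Sol p gam f h μ c w → 0 < w 1 := by
  obtain ⟨Wm, K0, hWm, hK0, hK, hW, -⟩ := sol_bounds X H
  have hf : ∀ s ∈ Icc p 1, f s ≠ 0 := fun s hs => (X.f_pos s hs).ne'
  have hp1 := X.p_lt
  obtain ⟨w0, h1, h2, h3⟩ := ode_exists H X.p_lt (A := fun s => h s / f s) (B := fun s => 0)
    (X.h_cont.div X.f_cont hf) continuousOn_const (fun s hs => le_rfl) one_pos
  have hw0 : StrictMonoOn w0 (Icc p 1) := by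
    apply strictMonoOn_of_deriv_pos (convex_Icc p 1) h1
    rw [interior_Icc]
    intro x hx
    rw [(h3 x hx).deriv, zero_mul, sub_zero]
    exact div_pos (X.h_pos x hx) (X.f_pos x ⟨hx.1.le, hx.2.le⟩)
  have hpos : 0 < w0 1 := by
    rw [← h2]; exact hw0 ⟨le_rfl, hp1.le⟩ ⟨hp1.le, le_rfl⟩ hp1
  have hlim : Tendsto (fun c => K0 * μ (c * Wm)) (𝓝 0) (𝓝 0) := by
    have : Continuous (fun c => K0 * μ (c * Wm)) := by
      have := H.cont; fun_prop
    have h := this.tendsto 0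
    simpa [H.zero 0 le_rfl] using h
  obtain ⟨δ, hδ, hδ'⟩ := Metric.eventually_nhds_iff.1 (hlim.eventually (gt_mem_nhds hpos))
  have hc := hδ' (y := δ / 2) (by rw [Real.dist_eq, sub_zero, abs_of_pos (by linarith)]; linarith)
  refine ⟨δ / 2, by linarith, fun w hw => ?_⟩
  have hcp : 0 < δ / 2 := by linarith
  set e := μ (δ / 2 * Wm)
  have he : 0 ≤ e := H.nonneg _
  have := cmp_le (φ := fun s => w0 s - w s - K0 * e * (s - p)) ((h1.sub hw.1).sub (by fun_prop))
      (fun x hx => ((h3 x hx).sub (hw.2.2 x hx)).sub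
        (((hasDerivAt_id x).sub_const p).const_mul (K0 * e)))
      (by simp [hw.2.1, h2]) (by
      intro x hx _
      have hx' : x ∈ Icc p 1 := ⟨hx.1.le, hx.2.le⟩
      have h4 : μ (δ / 2 * w x) ≤ e := H.mono (mul_le_mul_of_nonneg_left (hW _ w hcp hw x hx') hcp.le)
      have h5 : gam / f x * μ (δ / 2 * w x) ≤ gam / f x * e :=
        mul_le_mul_of_nonneg_left h4 (div_pos X.gam_pos (X.f_pos x hx')).le
      have h6 : gam / f x * e ≤ K0 * e := mul_le_mul_of_nonneg_right (hK x hx') he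
      have h7 : (h x - gam * μ (δ / 2 * w x)) / f x = h x / f x - gam / f x * μ (δ / 2 * w x) := by ring
      rw [h7]
      linarith) 1 ⟨hp1.le, le_rfl⟩
  have h8 : K0 * e * (1 - p) ≤ K0 * e * 1 :=
    mul_le_mul_of_nonneg_left (by linarith [X.p_pos]) (mul_nonneg hK0.le he)
  linarith

theorem sol_large (X : HData p sM gam f h h' G) (H : MuData D μ Φ) {a C1 m1 : ℝ} (ha : 1 < a)
    (hC1 : 0 < C1) (hm1 : 0 < m1) (hm1' : m1 < 1)
    (hD : ∀ m ∈ Ioo 0 m1, D m ≤ C1 * m ^ a) :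
    ∃ C, ∀ c w, C ≤ c → Sol p gam f h μ c w → ¬ 0 < w 1 := by
  obtain ⟨δ, q, hδ, hpδ, hq, hbar⟩ := sol_barrier X H ha hC1 hm1 hm1' hD one_pos
  obtain ⟨Wm, K0, hWm, hK0, hK, -, -⟩ := sol_bounds X H
  have hg := X.gam_pos
  have hp0 := X.p_pos
  set α := 1 / (a + 1) with hα
  have hα0 : 0 < α := by positivity
  set p0 := 1 - δ / 2 with hp0d
  -- minimum of G
  obtain ⟨x0, hx0, hx0m⟩ := isCompact_Icc.exists_isMinOn (nonempty_Icc.2 (show p ≤ p0 by linarith))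
    (X.G_cont.mono (Icc_subset_Icc_right (show p0 ≤ 1 by linarith)))
  set g0 := G x0 with hg0d
  have hg0 : 0 < g0 := X.G_pos x0 ⟨hx0.1, by linarith [hx0.2]⟩
  have hGmin : ∀ s ∈ Icc p p0, g0 ≤ G s := fun s hs => hx0m hs
  obtain ⟨P, hP1, hP2, hGP⟩ : ∃ P, p0 < P ∧ P < 1 ∧ G P < g0 / 2 := by
    have h1 := X.G_cont 1 ⟨X.p_lt.le, le_rfl⟩
    have h2 : ∀ᶠ s in 𝓝[Icc p 1] 1, G s < g0 / 2 :=
      h1.eventually (gt_mem_nhds (by rw [X.G_one]; linarith))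
    have h3 : ∀ᶠ s in 𝓝[<] (1:ℝ), G s < g0 / 2 := by
      apply nhdsWithin_le_of_mem _ h2
      filter_upwards [Ioo_mem_nhdsLT X.p_lt] with y hy
      exact ⟨hy.1.le, hy.2.le⟩
    obtain ⟨P, hP, hP'⟩ := (h3.and (Ioo_mem_nhdsLT (show p0 < 1 by linarith))).exists
    exact ⟨P, hP'.1, hP'.2, hP⟩
  set P2 := (P + 1) / 2 with hP2d
  set θ := gam / 2 * (q * (1 - P2) ^ α) with hθ
  have hθ0 : 0 < θ := by
    have : 0 < (1 - P2) ^ α := Real.rpow_pos_of_pos (by linarith) _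
    positivity
  set κ := θ * (P2 - P) with hκ
  have hκ0 : 0 < κ := mul_pos hθ0 (by linarith)
  set ε := min (min (κ / 2) (1 / 2)) (g0 / (4 * (1 + K0))) with hε
  have hε0 : 0 < ε := by positivity
  have hε1 : ε ≤ κ / 2 := (min_le_left _ _).trans (min_le_left _ _)
  have hε2 : ε ≤ 1 / 2 := (min_le_left _ _).trans (min_le_right _ _)
  have hε3 : ε * (4 * (1 + K0)) ≤ g0 := by
    have : ε ≤ g0 / (4 * (1 + K0)) := min_le_right _ _
    rwa [le_div_iff₀ (by positivity)] at this
  refine ⟨max 1 (Φ (1 - ε) / ε), ?_⟩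
  intro c w hc hw hw1
  have hc1 : 1 ≤ c := (le_max_left _ _).trans hc
  have hcp : 0 < c := by linarith
  have hc2 : Φ (1 - ε) ≤ c * ε := by
    have := (le_max_right _ _).trans hc
    rwa [div_le_iff₀ hε0] at this
  have hb := hbar c w hc1 hw hw1
  have hnn := sol_nonneg X H hcp hw
  have hanti : AntitoneOn (fun s => w s + θ * s) (Icc p0 P2) := by
    apply anti_of (φ' := fun s => (h s - gam * μ (c * w s)) / f s + θ * 1)
    · exact (hw.1.mono (Icc_subset_Icc (by linarith) (by linarith))).add (by fun_prop)
    · intro x hx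
      exact (hw.2.2 x ⟨by linarith [hx.1], by linarith [hx.2]⟩).add ((hasDerivAt_id x).const_mul θ)
    · intro x hx
      have hx' : x ∈ Icc p 1 := ⟨by linarith [hx.1], by linarith [hx.2]⟩
      obtain ⟨b1, b2⟩ := hb x ⟨by linarith [hx.1], by linarith [hx.2]⟩
      have hr : (1 - P2) ^ α ≤ (1 - x) ^ α :=
        Real.rpow_le_rpow (by linarith) (by linarith [hx.2]) hα0.le
      have b3 : θ ≤ gam / 2 * (q * (1 - x) ^ α) :=
        mul_le_mul_of_nonneg_left (mul_le_mul_of_nonneg_left hr hq.le) (by linarith)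
      have b4 := mul_le_mul_of_nonneg_left b1 hg.le
      have b5 : h x - gam * μ (c * w x) ≤ - θ := by linarith
      have b6 : (h x - gam * μ (c * w x)) / f x ≤ - θ := by
        rw [div_le_iff₀ (X.f_pos x hx')]
        have := mul_le_mul_of_nonneg_left (X.f_le x hx') hθ0.le
        linarith
      linarith
  have hlow : ∀ s ∈ Icc p0 P, κ ≤ w s := by
    intro s hs
    have h1 := hanti ⟨hs.1, by linarith [hs.2]⟩ ⟨by linarith [hs.1, hs.2], le_rfl⟩
      (show s ≤ P2 by linarith [hs.2])
    simp only at h1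
    have h2 := hnn P2 ⟨by linarith, by linarith⟩
    have h3 := mul_le_mul_of_nonneg_left (show P2 - P ≤ P2 - s by linarith [hs.2]) hθ0.le
    rw [hκ]
    linarith
  have hfin := cmp_le (φ := fun s => w s - ε - (G s - g0) - K0 * ε * (s - p)) (p := p) (q := P)
    (φ' := fun s => (h s - gam * μ (c * w s)) / f s - (h s - gam) / f s - K0 * ε * 1)
    (by
      have hsub : Icc p P ⊆ Icc p 1 := Icc_subset_Icc_right hP2.le
      exact (((hw.1.mono hsub).sub continuousOn_const).sub ((X.G_cont.mono hsub).sub continuousOn_const)).sub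
        (by fun_prop))
    (fun x hx => (((hw.2.2 x ⟨hx.1, hx.2.trans hP2⟩).sub_const ε).sub
      ((X.G_deriv x ⟨hx.1, hx.2.trans hP2⟩).sub_const g0)).sub
        (((hasDerivAt_id x).sub_const p).const_mul (K0 * ε)))
    (by
      have := hGmin p ⟨le_rfl, by linarith⟩
      simp only [hw.2.1, sub_self, mul_zero]
      linarith)
    (by
      intro x hx hpos
      have hx' : x ∈ Icc p 1 := ⟨hx.1.le, by linarith [hx.2]⟩
      have hwε : ε ≤ w x := by
        rcases le_total x p0 with hxp | hxp
        · have h1 := hGmin x ⟨hx.1.le, hxp⟩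
          have h2 : 0 ≤ K0 * ε * (x - p) :=
            mul_nonneg (mul_nonneg hK0.le hε0.le) (by linarith [hx.1])
          linarith
        · have := hlow x ⟨hxp, hx.2.le⟩
          linarith
      have h3 : 1 - ε ≤ μ (c * w x) := by
        rw [← H.mu_phi (1 - ε) ⟨by linarith, by linarith⟩]
        exact H.mono (hc2.trans (mul_le_mul_of_nonneg_left hwε hcp.le))
      have h4 : (h x - gam * μ (c * w x)) / f x - (h x - gam) / f x = gam / f x * (1 - μ (c * w x)) := by
        ring
      rw [h4]
      have h5 : gam / f x * (1 - μ (c * w x)) ≤ gam / f x * ε :=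
        mul_le_mul_of_nonneg_left (by linarith) (div_pos hg (X.f_pos x hx')).le
      have h6 := mul_le_mul_of_nonneg_right (hK x hx') hε0.le
      linarith) P ⟨by linarith, le_rfl⟩
  have h7 := hnn P ⟨by linarith, hP2.le⟩
  have h8 : K0 * ε * (P - p) ≤ K0 * ε * 1 :=
    mul_le_mul_of_nonneg_left (by linarith) (mul_nonneg hK0.le hε0.le)
  linarith

theorem sol_cstar (X : HData p sM gam f h h' G) (H : MuData D μ Φ) {a C1 m1 : ℝ} (ha : 1 < a)
    (hC1 : 0 < C1) (hm1 : 0 < m1) (hm1' : m1 < 1)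
    (hD : ∀ m ∈ Ioo 0 m1, D m ≤ C1 * m ^ a) :
    ∃ c > 0, ∃ w, Sol p gam f h μ c w ∧ w 1 = 0 ∧ ∃ δ q : ℝ, 0 < δ ∧ p < 1 - δ ∧ 0 < q ∧
      ∀ s ∈ Ioo (1 - δ) 1, q * (1 - s) ^ (1 / (a + 1)) ≤ μ (c * w s) := by
  obtain ⟨c0, hc0, hc0'⟩ := sol_small X H
  obtain ⟨C, hC⟩ := sol_large X H ha hC1 hm1 hm1' hD
  obtain ⟨Wm, K0, hWm, hK0, hK, hW, hcont⟩ := sol_bounds X H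
  have hp1 := X.p_lt
  have h1mem : (1:ℝ) ∈ Icc p 1 := ⟨hp1.le, le_rfl⟩
  have hex : ∀ c : ℝ, ∃ w, 0 < c → Sol p gam f h μ c w := by
    intro c
    by_cases hc : 0 < c
    · obtain ⟨w, hw⟩ := sol_exists X H hc
      exact ⟨w, fun _ => hw⟩
    · exact ⟨0, fun h => absurd h hc⟩
  choose W hWs using hex
  set T : Set ℝ := {c | 0 < c ∧ 0 < W c 1} with hT
  have hTne : T.Nonempty := ⟨c0, hc0, hc0' _ (hWs c0 hc0)⟩
  have hTb : BddAbove T := by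
    refine ⟨C, fun c hc => ?_⟩
    by_contra hlt
    push Not at hlt
    exact hC c (W c) hlt.le (hWs c hc.1) hc.2
  set cs := sSup T with hcs
  have hcs0 : 0 < cs := lt_of_lt_of_le hc0 (le_csSup hTb ⟨hc0, hc0' _ (hWs c0 hc0)⟩)
  have hlimc : ∀ c1 : ℝ, Tendsto (fun c => K0 * μ ((c - c1) * Wm)) (𝓝 c1) (𝓝 0) := by
    intro c1
    have : Continuous (fun c => K0 * μ ((c - c1) * Wm)) := by
      have := H.cont; fun_prop
    have h := this.tendsto c1
    simpa [H.zero 0 le_rfl] using h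
  have hlimc' : ∀ c1 : ℝ, Tendsto (fun c => K0 * μ ((c1 - c) * Wm)) (𝓝 c1) (𝓝 0) := by
    intro c1
    have : Continuous (fun c => K0 * μ ((c1 - c) * Wm)) := by
      have := H.cont; fun_prop
    have h := this.tendsto c1
    simpa [H.zero 0 le_rfl] using h
  have hbelow : ∀ c, 0 < c → c < cs → 0 < W c 1 := by
    intro c hc hlt
    obtain ⟨c', hc', hlt'⟩ := exists_lt_of_lt_csSup hTne hlt
    exact hc'.2.trans_le (sol_mono X H hc hlt'.le (hWs c hc) (hWs c' hc'.1) 1 h1mem)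
  have hzero : W cs 1 = 0 := by
    refine le_antisymm ?_ (sol_nonneg X H hcs0 (hWs cs hcs0) 1 h1mem)
    by_contra hlt
    push Not at hlt
    have h1 : ∀ᶠ c in 𝓝[>] cs, K0 * μ ((c - cs) * Wm) < W cs 1 :=
      nhdsWithin_le_nhds ((hlimc cs).eventually (gt_mem_nhds hlt))
    obtain ⟨c, hc1, hc2⟩ := (h1.and self_mem_nhdsWithin).exists
    have hc2' : cs < c := hc2
    have hcp : 0 < c := hcs0.trans hc2'
    have h2 := hcont cs (W cs) c (W c) hcs0 hc2'.le (hWs cs hcs0) (hWs c hcp) 1 h1mem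
    have h3 : c ∈ T := ⟨hcp, by linarith⟩
    have := le_csSup hTb h3
    linarith
  obtain ⟨δ, q, hδ, hpδ, hq, hbar⟩ := sol_barrier X H ha hC1 hm1 hm1' hD
    (show 0 < cs / 2 by linarith)
  refine ⟨cs, hcs0, W cs, hWs cs hcs0, hzero, δ, q, hδ, hpδ, hq, ?_⟩
  intro s hs
  have hs' : s ∈ Icc p 1 := ⟨by linarith [hs.1], hs.2.le⟩
  have hIoo : Ioo (cs / 2) cs ∈ 𝓝[<] cs := Ioo_mem_nhdsLT (by linarith)
  have hWlim : Tendsto (fun c => W c s) (𝓝[<] cs) (𝓝 (W cs s)) := by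
    have hup : Tendsto (fun c => W cs s + K0 * μ ((cs - c) * Wm)) (𝓝[<] cs) (𝓝 (W cs s + 0)) :=
      ((hlimc' cs).mono_left nhdsWithin_le_nhds).const_add _
    rw [add_zero] at hup
    refine tendsto_of_tendsto_of_tendsto_of_le_of_le' tendsto_const_nhds hup ?_ ?_
    · filter_upwards [hIoo] with c hc
      have hcp : 0 < c := by linarith [hc.1]
      exact sol_mono X H hcp hc.2.le (hWs c hcp) (hWs cs hcs0) s hs'
    · filter_upwards [hIoo] with c hc
      have hcp : 0 < c := by linarith [hc.1]
      exact hcont c (W c) cs (W cs) hcp hc.2.le (hWs c hcp) (hWs cs hcs0) s hs'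
  have hid : Tendsto (fun c : ℝ => c) (𝓝[<] cs) (𝓝 cs) := nhdsWithin_le_nhds
  have hlim := (H.cont.tendsto (cs * W cs s)).comp (hid.mul hWlim)
  refine ge_of_tendsto hlim ?_
  filter_upwards [hIoo] with c hc
  have hcp : 0 < c := by linarith [hc.1]
  exact (hbar c (W c) hc.1.le (hWs c hcp) (hbelow c hcp hc.2) s hs).1
end

theorem build_S {p : ℝ} (hp : p < 1) {g : ℝ → ℝ} (hg : ContinuousOn g (Icc p 1)) (hgp : g p = 0)
    (hg1 : g 1 = 0) (hpos : ∀ s ∈ Ioo p 1, 0 < g s)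
    (hint : ∀ r ∈ Ioo p 1, IntervalIntegrable (fun s => 1 / g s) MeasureTheory.volume r 1) :
    ∃ S : ℝ → ℝ, (∀ ξ, S ξ ∈ Icc p 1) ∧ (∀ ξ, HasDerivAt S (g (S ξ)) ξ) ∧
      (∀ ξ, 0 ≤ ξ → S ξ = 1) ∧ Tendsto S atBot (𝓝 p) := by
  set X : ℝ → ℝ := fun s => ∫ x in (1:ℝ)..s, 1 / g x with hX
  have hXd : ∀ s ∈ Ioo p 1, HasDerivAt X (1 / g s) s := by
    intro s hs
    have hc : ContinuousOn (fun s => 1 / g s) (Ioo p 1) :=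
      continuousOn_const.div (hg.mono Ioo_subset_Icc_self) (fun x hx => (hpos x hx).ne')
    have hn : Ioo p 1 ∈ 𝓝 s := Ioo_mem_nhds hs.1 hs.2
    refine intervalIntegral.integral_hasDerivAt_right (hint s hs).symm ?_ (hc.continuousAt hn)
    exact hc.stronglyMeasurableAtFilter_nhdsWithin measurableSet_Ioo s |>.filter_mono (by
      rw [nhdsWithin_eq_nhds.2 hn])
  have hXm : StrictMonoOn X (Ioo p 1) := by
    apply strictMonoOn_of_deriv_pos (convex_Ioo p 1)
      (fun s hs => (hXd s hs).continuousAt.continuousWithinAt)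
    rw [interior_Ioo]
    intro x hx
    rw [(hXd x hx).deriv]
    exact one_div_pos.2 (hpos x hx)
  have hXneg : ∀ s ∈ Ioo p 1, X s ≤ 0 := by
    intro s hs
    have : X s = - ∫ x in s..1, 1 / g x := intervalIntegral.integral_symm _ _
    rw [this, neg_nonpos]
    apply intervalIntegral.integral_nonneg hs.2.le
    intro u hu
    rcases hu.2.lt_or_eq with h1 | h1
    · exact (one_div_pos.2 (hpos u ⟨hs.1.trans_le hu.1, h1⟩)).le
    · rw [h1, hg1]; simp
  set T : ℝ → Set ℝ := fun ξ => insert p {s ∈ Ioo p 1 | X s ≤ ξ} with hT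
  have hTne : ∀ ξ, (T ξ).Nonempty := fun ξ => ⟨p, mem_insert _ _⟩
  have hTsub : ∀ ξ, ∀ s ∈ T ξ, s ∈ Icc p 1 := by
    intro ξ s hs
    rcases hs with h | h
    · rw [h]; exact ⟨le_rfl, hp.le⟩
    · exact ⟨h.1.1.le, h.1.2.le⟩
  have hTb : ∀ ξ, BddAbove (T ξ) := fun ξ => ⟨1, fun s hs => (hTsub ξ s hs).2⟩
  set S : ℝ → ℝ := fun ξ => sSup (T ξ) with hS
  have hSmem : ∀ ξ, S ξ ∈ Icc p 1 := fun ξ =>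
    ⟨le_csSup (hTb ξ) (mem_insert _ _), csSup_le (hTne ξ) (fun s hs => (hTsub ξ s hs).2)⟩
  have hSge : ∀ ξ, ∀ s ∈ Ioo p 1, X s ≤ ξ → s ≤ S ξ := fun ξ s hs h =>
    le_csSup (hTb ξ) (mem_insert_of_mem _ ⟨hs, h⟩)
  have hSle : ∀ ξ, ∀ s ∈ Ioo p 1, ξ ≤ X s → S ξ ≤ s := by
    intro ξ s hs h
    refine csSup_le (hTne ξ) (fun y hy => ?_)
    rcases hy with hy | hy
    · rw [hy]; exact hs.1.le
    · exact (hXm.le_iff_le hy.1 hs).1 (hy.2.trans h)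
  have hSX : ∀ s ∈ Ioo p 1, S (X s) = s := fun s hs =>
    le_antisymm (hSle _ s hs le_rfl) (hSge _ s hs le_rfl)
  have hSmono : Monotone S := by
    intro x y hxy
    refine csSup_le_csSup (hTb y) (hTne x) ?_
    apply insert_subset_insert
    exact fun s hs => ⟨hs.1, hs.2.trans hxy⟩
  have hScont : Continuous S := by
    rw [continuous_iff_continuousAt]
    intro ξ
    rw [ContinuousAt, tendsto_order]
    constructor
    · intro l hl
      rcases lt_or_ge l p with h | h
      · exact Eventually.of_forall (fun y => h.trans_le (hSmem y).1)
      · obtain ⟨s, hs1, hs2⟩ := exists_between hl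
        have hs : s ∈ Ioo p 1 := ⟨h.trans_lt hs1, hs2.trans_le (hSmem ξ).2⟩
        have hlt : X s < ξ := by
          by_contra hcon
          push Not at hcon
          have := hSle ξ s hs hcon
          linarith
        filter_upwards [lt_mem_nhds hlt] with y hy
        exact hs1.trans_le (hSge y s hs hy.le)
    · intro l hl
      rcases lt_or_ge 1 l with h | h
      · exact Eventually.of_forall (fun y => (hSmem y).2.trans_lt h)
      · obtain ⟨s, hs1, hs2⟩ := exists_between hl
        have hs : s ∈ Ioo p 1 := ⟨(hSmem ξ).1.trans_lt hs1, hs2.trans_le h⟩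
        have hlt : ξ < X s := by
          by_contra hcon
          push Not at hcon
          have := hSge ξ s hs hcon
          linarith
        filter_upwards [gt_mem_nhds hlt] with y hy
        exact (hSle y s hs hy.le).trans_lt hs2
  have hXS : ∀ ξ, S ξ ∈ Ioo p 1 → X (S ξ) = ξ := by
    intro ξ hs
    have hXc := (hXd _ hs).continuousAt
    have hn : Ioo p 1 ∈ 𝓝 (S ξ) := Ioo_mem_nhds hs.1 hs.2
    rcases lt_trichotomy (X (S ξ)) ξ with h | h | h
    · exfalso
      have h1 := (hXc.eventually (gt_mem_nhds h)).and hn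
      have h2 : ∀ᶠ s in 𝓝[>] (S ξ), X s < ξ ∧ s ∈ Ioo p 1 := nhdsWithin_le_nhds h1
      obtain ⟨s, hs1, hs2⟩ := (h2.and self_mem_nhdsWithin).exists
      have := hSge ξ s hs1.2 hs1.1.le
      exact absurd hs2 (not_lt.2 this)
    · exact h
    · exfalso
      have h1 := (hXc.eventually (lt_mem_nhds h)).and hn
      have h2 : ∀ᶠ s in 𝓝[<] (S ξ), ξ < X s ∧ s ∈ Ioo p 1 := nhdsWithin_le_nhds h1
      obtain ⟨s, hs1, hs2⟩ := (h2.and self_mem_nhdsWithin).exists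
      have := hSle ξ s hs1.2 hs1.1.le
      exact absurd hs2 (not_lt.2 this)
  have hSd0 : ∀ ξ, S ξ ∈ Ioo p 1 → HasDerivAt S (g (S ξ)) ξ := by
    intro ξ hs
    have := HasDerivAt.of_local_left_inverse (f := X) (g := S) (hScont.continuousAt (x := ξ)) (hXd _ hs)
      (one_div_pos.2 (hpos _ hs)).ne' (by
        filter_upwards [hScont.continuousAt.preimage_mem_nhds (Ioo_mem_nhds hs.1 hs.2)] with y hy
        exact hXS y hy)
    simpa using this
  set E1 : Set ℝ := {ξ | S ξ = 1 ∧ ∀ y < ξ, S y ≠ 1}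
  set E2 : Set ℝ := {ξ | S ξ = p ∧ ∀ y > ξ, S y ≠ p}
  have hE1 : E1.Subsingleton := by
    intro x hx y hy
    rcases lt_trichotomy x y with h | h | h
    · exact absurd hx.1 (hy.2 x h)
    · exact h
    · exact absurd hy.1 (hx.2 y h)
  have hE2 : E2.Subsingleton := by
    intro x hx y hy
    rcases lt_trichotomy x y with h | h | h
    · exact absurd hy.1 (hx.2 y h)
    · exact h
    · exact absurd hx.1 (hy.2 x h)
  have hSd1 : ∀ ξ, ξ ∉ E1 ∪ E2 → HasDerivAt S (g (S ξ)) ξ := by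
    intro ξ hξ
    rcases (hSmem ξ).1.eq_or_lt with h1 | h1
    · -- S ξ = p
      have : ∃ y > ξ, S y = p := by
        by_contra hcon
        push Not at hcon
        exact hξ (Or.inr ⟨h1.symm, hcon⟩)
      obtain ⟨y, hy, hy'⟩ := this
      rw [← h1, hgp]
      refine (hasDerivAt_const ξ p).congr_of_eventuallyEq ?_
      filter_upwards [gt_mem_nhds hy] with z hz
      exact le_antisymm (hy' ▸ hSmono hz.le) (hSmem z).1
    · rcases (hSmem ξ).2.eq_or_lt with h2 | h2
      · have : ∃ y < ξ, S y = 1 := by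
          by_contra hcon
          push Not at hcon
          exact hξ (Or.inl ⟨h2, hcon⟩)
        obtain ⟨y, hy, hy'⟩ := this
        rw [h2, hg1]
        refine (hasDerivAt_const ξ 1).congr_of_eventuallyEq ?_
        filter_upwards [lt_mem_nhds hy] with z hz
        exact le_antisymm (hSmem z).2 (hy' ▸ hSmono hz.le)
      · exact hSd0 ξ ⟨h1, h2⟩
  have hgS : Continuous (fun ξ => g (S ξ)) := by
    rw [← continuousOn_univ]
    exact hg.comp hScont.continuousOn (fun x _ => hSmem x)
  refine ⟨S, hSmem, ?_, ?_, ?_⟩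
  · intro ξ
    have hftc : ∀ y, S y = S 0 + ∫ x in (0:ℝ)..y, g (S x) := by
      intro y
      have := MeasureTheory.integral_eq_of_hasDerivAt_off_countable S (fun x => g (S x)) (a := 0) (b := y)
        (s := E1 ∪ E2) (hE1.countable.union hE2.countable) hScont.continuousOn
        (fun x hx => hSd1 x hx.2) (hgS.intervalIntegrable _ _)
      linarith
    have h1 : HasDerivAt (fun y => S 0 + ∫ x in (0:ℝ)..y, g (S x)) (g (S ξ)) ξ :=
      (hgS.integral_hasStrictDerivAt 0 ξ).hasDerivAt.const_add _
    exact h1.congr_of_eventuallyEq (Eventually.of_forall hftc)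
  · intro ξ hξ
    refine le_antisymm (hSmem ξ).2 ?_
    by_contra hcon
    push Not at hcon
    obtain ⟨s, hs1, hs2⟩ := exists_between hcon
    have hs : s ∈ Ioo p 1 := ⟨(hSmem ξ).1.trans_lt hs1, hs2⟩
    have := hSge ξ s hs ((hXneg s hs).trans hξ)
    linarith
  · rw [tendsto_order]
    constructor
    · intro l hl
      exact Eventually.of_forall (fun y => hl.trans_le (hSmem y).1)
    · intro l hl
      obtain ⟨s, hs1, hs2⟩ := exists_between (lt_min hl hp)
      have hs : s ∈ Ioo p 1 := ⟨hs1, hs2.trans_le (min_le_right _ _)⟩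
      filter_upwards [eventually_le_atBot (X s)] with y hy
      exact (hSle y s hs hy).trans_lt (hs2.trans_le (min_le_left _ _))

theorem tw_exists {p sM gam lam a C1 m1 : ℝ} {f F h' G D μ Φ : ℝ → ℝ}
    (X : HData p sM gam f (fun s => 1 - s - lam * F s) h' G) (H : MuData D μ Φ)
    (hDp : ∀ m ∈ Ioo (0:ℝ) 1, 0 < D m)
    (ha : 1 < a) (hC1 : 0 < C1) (hm1 : 0 < m1) (hm1' : m1 < 1)
    (hD : ∀ m ∈ Ioo 0 m1, D m ≤ C1 * m ^ a) :
    ∃ v, 0 < v ∧ ∃ M S : ℝ → ℝ, IsTW lam gam v p f F D M S := by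
  obtain ⟨c, hc, w, hw, hw1, δ, q, hδ, hpδ, hq, hlow⟩ := sol_cstar X H ha hC1 hm1 hm1' hD
  have hg := X.gam_pos
  have hsc : 0 < √c := Real.sqrt_pos.2 hc
  set v := gam * √c with hv
  have hvpos : 0 < v := mul_pos hg hsc
  set m : ℝ → ℝ := fun s => μ (c * w s) with hm
  have hmc : ContinuousOn m (Icc p 1) :=
    H.cont.comp_continuousOn (continuousOn_const.mul hw.1)
  have hmp : m p = 0 := by simp only [hm, hw.2.1]; exact H.zero _ (by simp)
  have hm1e : m 1 = 0 := by simp only [hm, hw1]; exact H.zero _ (by simp)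
  have hwpos := sol_pos X H hc hw
  have hmpos : ∀ s ∈ Ioo p 1, 0 < m s := fun s hs => H.pos _ (mul_pos hc (hwpos s hs))
  set g : ℝ → ℝ := fun s => gam / v * (f s * m s) with hgd
  have hgc : ContinuousOn g (Icc p 1) := continuousOn_const.mul (X.f_cont.mul hmc)
  have hgpos : ∀ s ∈ Ioo p 1, 0 < g s := fun s hs =>
    mul_pos (div_pos hg hvpos) (mul_pos (X.f_pos s ⟨hs.1.le, hs.2.le⟩) (hmpos s hs))
  have hgcd : ContinuousOn (fun s => 1 / g s) (Ioo p 1) :=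
    continuousOn_const.div (hgc.mono Ioo_subset_Icc_self) (fun x hx => (hgpos x hx).ne')
  obtain ⟨x0, hx0, hx0m⟩ := isCompact_Icc.exists_isMinOn (nonempty_Icc.2 X.p_lt.le) X.f_cont
  have hf0 := X.f_pos x0 hx0
  have hfm : ∀ s ∈ Icc p 1, f x0 ≤ f s := fun s hs => hx0m hs
  have hint : ∀ r ∈ Ioo p 1, IntervalIntegrable (fun s => 1 / g s) MeasureTheory.volume r 1 := by
    intro r hr
    set t := max r (1 - δ / 2) with ht
    have htp : t ∈ Ioo p 1 := ⟨hr.1.trans_le (le_max_left _ _), max_lt hr.2 (by linarith)⟩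
    have h1 : IntervalIntegrable (fun s => 1 / g s) MeasureTheory.volume r t := by
      apply ContinuousOn.intervalIntegrable
      rw [uIcc_of_le (le_max_left _ _)]
      exact hgcd.mono (fun x hx => ⟨hr.1.trans_le hx.1, hx.2.trans_lt htp.2⟩)
    have h2 : IntervalIntegrable (fun s => 1 / g s) MeasureTheory.volume t 1 := by
      have hb : IntervalIntegrable (fun s : ℝ => (v / gam / f x0 / q) * (1 - s) ^ (-(1 / (a + 1))))
          MeasureTheory.volume t 1 := by
        apply IntervalIntegrable.const_mul
        have h3 : IntervalIntegrable (fun x : ℝ => x ^ (-(1 / (a + 1)))) MeasureTheory.volume (1 - t) (1 - 1) := by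
          apply intervalIntegral.intervalIntegrable_rpow'
          rw [neg_lt_neg_iff, div_lt_one (by linarith)]; linarith
        have := h3.comp_sub_left 1
        simpa using this
      rw [intervalIntegrable_iff_integrableOn_Ioo_of_le htp.2.le] at hb ⊢
      refine MeasureTheory.Integrable.mono' hb ?_ ?_
      · exact (hgcd.mono (fun x hx => ⟨htp.1.trans hx.1, hx.2⟩)).aestronglyMeasurable measurableSet_Ioo
      · refine (MeasureTheory.ae_restrict_iff' measurableSet_Ioo).2 (Eventually.of_forall ?_)
        intro s hs
        have hs' : s ∈ Ioo p 1 := ⟨htp.1.trans hs.1, hs.2⟩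
        have hsδ : s ∈ Ioo (1 - δ) 1 := ⟨by
          have := le_max_right r (1 - δ / 2); have := hs.1; linarith, hs.2⟩
        have hl := hlow s hsδ
        have h1s : 0 < 1 - s := by linarith [hs.2]
        rw [Real.norm_of_nonneg (one_div_pos.2 (hgpos s hs')).le]
        have hrp : 0 < (1 - s) ^ (1 / (a + 1)) := Real.rpow_pos_of_pos h1s _
        rw [Real.rpow_neg h1s.le]
        have e : v / gam / f x0 / q * ((1 - s) ^ (1 / (a + 1)))⁻¹ =
            1 / (gam / v * (f x0 * (q * (1 - s) ^ (1 / (a + 1))))) := by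
          field_simp
        rw [e]
        apply one_div_le_one_div_of_le (by positivity)
        simp only [hgd]
        have := hfm s (Ioo_subset_Icc_self hs')
        gcongr
        exact X.f_pos s (Ioo_subset_Icc_self hs') |>.le
    exact h1.trans h2
  obtain ⟨S, hS1, hS2, hS3, hS4⟩ := build_S X.p_lt hgc (by simp [hgd, hmp]) (by simp [hgd, hm1e]) hgpos hint
  have hSc : Continuous S := continuous_iff_continuousAt.2 fun x => (hS2 x).continuousAt
  refine ⟨v, hvpos, fun ξ => m (S ξ), S, fun ξ => ⟨H.nonneg _, H.lt_one _⟩,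
    fun ξ => ⟨X.p_pos.trans_le (hS1 ξ).1, (hS1 ξ).2⟩, ?_, hS2, ?_, ?_, ?_, hS4⟩
  · rw [← continuousOn_univ]
    exact hmc.comp hSc.continuousOn (fun x _ => hS1 x)
  · intro ξ hM
    have hs : S ξ ∈ Ioo p 1 := by
      refine ⟨lt_of_le_of_ne (hS1 ξ).1 ?_, lt_of_le_of_ne (hS1 ξ).2 ?_⟩
      · intro h; simp only [← h, hmp] at hM; exact lt_irrefl _ hM
      · intro h; simp only [h, hm1e] at hM; exact lt_irrefl _ hM
    have hf := X.f_pos _ (Ioo_subset_Icc_self hs)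
    have hd := hDp _ ⟨hM, H.lt_one _⟩
    have d1 := (hw.2.2 _ hs).const_mul c
    have d2 := HasDerivAt.comp (h := fun y => c * w y) (S ξ) (H.deriv _ (mul_pos hc (hwpos _ hs))) d1
    have d3 := d2.comp ξ (hS2 ξ)
    refine ⟨_, d3, ?_⟩
    simp only [hgd]
    have hMp : 0 < μ (c * w (S ξ)) := hM
    have hd' : 0 < D (μ (c * w (S ξ))) := hd
    have hcv : c * gam ^ 2 = v ^ 2 := by rw [hv, mul_pow, Real.sq_sqrt hc.le]; ring
    simp only [hm]
    field_simp
    rw [← hcv]; ring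
  · intro ξ hξ
    exact ⟨by simp only [hS3 ξ hξ, hm1e], hS3 ξ hξ⟩
  · have h1 : Tendsto m (𝓝[Icc p 1] p) (𝓝 0) := hmp ▸ hmc p ⟨le_rfl, X.p_lt.le⟩
    exact h1.comp (tendsto_nhdsWithin_iff.2 ⟨hS4, Eventually.of_forall hS1⟩)

structure MProf (p gam v : ℝ) (f h D m X : ℝ → ℝ) : Prop where
  cont : Continuous m
  at_p : m p = 0
  at_one : m 1 = 0
  pos : ∀ s ∈ Ioo p 1, 0 < m s
  lt_one : ∀ s, m s < 1
  nonneg : ∀ s, 0 ≤ m s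
  X_le : ∀ s, X s ≤ 0
  X_deriv : ∀ s ∈ Ioo p 1, HasDerivAt X (v / (gam * f s * m s)) s
  m_deriv : ∀ s ∈ Ioo p 1,
    HasDerivAt m ((v ^ 2 / gam ^ 2) * (h s - gam * m s) / (f s * D (m s) * m s)) s

theorem tw_profile {p sM gam lam v : ℝ} {f F h' G D M S : ℝ → ℝ}
    (Y : HData p sM gam f (fun s => 1 - s - lam * F s) h' G)
    (hDp : ∀ m ∈ Ioo (0:ℝ) 1, 0 < D m)
    (hf0 : ∀ s ∈ Ioc (0:ℝ) 1, 0 < f s)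
    (hv : 0 < v) (T : IsTW lam gam v p f F D M S) :
    ∃ m X, MProf p gam v f (fun s => 1 - s - lam * F s) D m X := by
  obtain ⟨hM, hS, hMc, hSd, hMd, hend, hM0, hSp⟩ := T
  have hg := Y.gam_pos
  have hgv : 0 < gam / v := div_pos hg hv
  have hSc : Continuous S := continuous_iff_continuousAt.2 fun x => (hSd x).continuousAt
  have hSm : Monotone S := by
    apply monotone_of_deriv_nonneg (fun x => (hSd x).differentiableAt)
    intro x
    rw [(hSd x).deriv]
    exact mul_nonneg hgv.le (mul_nonneg (hf0 _ (hS x)).le (hM x).1)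
  have hSge : ∀ ξ, p ≤ S ξ := fun ξ => hSm.le_of_tendsto hSp ξ
  have hA0 : ∀ ξ, gam / v * (f (S ξ) * M ξ) = 0 → M ξ = 0 := by
    intro ξ h
    rcases mul_eq_zero.1 h with h | h
    · exact absurd h hgv.ne'
    · rcases mul_eq_zero.1 h with h | h
      · exact absurd h (hf0 _ (hS ξ)).ne'
      · exact h
  have hA : ∀ ξ, 0 < M ξ → S ξ ∈ Ioo p 1 := by
    intro ξ hpos
    refine ⟨lt_of_le_of_ne (hSge ξ) ?_, lt_of_le_of_ne (hS ξ).2 ?_⟩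
    · intro h
      have : IsLocalMin S ξ := Eventually.of_forall (fun y => h ▸ hSge y)
      exact hpos.ne' (hA0 ξ (this.hasDerivAt_eq_zero (hSd ξ)))
    · intro h
      have : IsLocalMax S ξ := Eventually.of_forall (fun y => h.symm ▸ (hS y).2)
      exact hpos.ne' (hA0 ξ (this.hasDerivAt_eq_zero (hSd ξ)))
  have hB : ∀ ξ, S ξ ∈ Ioo p 1 → 0 < M ξ := by
    intro ξ1 hs1
    by_contra hcon
    have hz1 : M ξ1 = 0 := le_antisymm (not_lt.1 hcon) (hM ξ1).1
    obtain ⟨y, hy1, hy2⟩ := ((hSp.eventually (gt_mem_nhds hs1.1)).and (eventually_lt_atBot ξ1)).exists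
    obtain ⟨ξ2, hξ2, hsl⟩ := exists_hasDerivAt_eq_slope S _ hy2 hSc.continuousOn (fun x _ => hSd x)
    have hslp : 0 < (S ξ1 - S y) / (ξ1 - y) := div_pos (by linarith) (by linarith)
    have hM2 : 0 < M ξ2 := by
      refine lt_of_le_of_ne (hM ξ2).1 (fun h => ?_)
      rw [← hsl, ← h] at hslp
      simp at hslp
    have hS2 := hA ξ2 hM2
    obtain ⟨ζ, ⟨hζ1, hζ0⟩, hζmin⟩ :=
      (isCompact_Icc (a := ξ2) (b := ξ1)).inter_right (isClosed_singleton.preimage hMc)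
        |>.exists_isLeast ⟨ξ1, ⟨hξ2.2.le, le_rfl⟩, hz1⟩
    have hζ0 : M ζ = 0 := hζ0
    have hMpos : ∀ x ∈ Ioo ξ2 ζ, 0 < M x := by
      intro x hx
      refine lt_of_le_of_ne (hM x).1 (fun h => ?_)
      exact absurd (hζmin ⟨⟨hx.1.le, hx.2.le.trans hζ1.2⟩, h.symm⟩) (not_le.2 hx.2)
    have hSin : ∀ x ∈ Icc ξ2 ζ, S x ∈ Ioo p 1 := fun x hx =>
      ⟨hS2.1.trans_le (hSm hx.1), (hSm (hx.2.trans hζ1.2)).trans_lt hs1.2⟩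
    have hhc : ContinuousOn (fun x => 1 - S x - lam * F (S x)) (Icc ξ2 ζ) :=
      Y.h_cont.comp hSc.continuousOn (fun x hx => Ioo_subset_Icc_self (hSin x hx))
    obtain ⟨x0, hx0, hx0m⟩ := isCompact_Icc.exists_isMinOn (nonempty_Icc.2 hζ1.1) hhc
    have hη := Y.h_pos _ (hSin x0 hx0)
    set η := 1 - S x0 - lam * F (S x0) with hηd
    set ε := min (M ξ2) (η / gam) with hε
    have hεp : 0 < ε := lt_min hM2 (div_pos hη hg)
    choose! M' hM'1 hM'2 using hMd
    have := cmp_le (φ := fun x => ε - M x) (φ' := fun x => - M' x) (p := ξ2) (q := ζ)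
      (continuousOn_const.sub hMc.continuousOn)
      (fun x hx => (hM'1 x (hMpos x hx)).const_sub ε) (by simp [hε]) (by
        intro x hx hpos
        have h1 := hM'2 x (hMpos x hx)
        have h2 : η ≤ 1 - S x - lam * F (S x) := hx0m (Ioo_subset_Icc_self hx)
        have h3 : M x < η / gam := by have := min_le_right (M ξ2) (η / gam); linarith
        rw [lt_div_iff₀ hg] at h3
        have hd := hDp _ ⟨hMpos x hx, (hM x).2⟩
        have h4 : 0 ≤ D (M x) * M' x := by
          rw [h1]; exact mul_nonneg (div_pos hv hg).le (by linarith)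
        have := nonneg_of_mul_nonneg_right h4 hd
        linarith) ζ ⟨hζ1.1, le_rfl⟩
    simp only [hζ0] at this
    linarith
  have hstrict : ∀ x y, x < y → S x ∈ Ioo p 1 → S x < S y := by
    intro x y hxy hx
    refine lt_of_le_of_ne (hSm hxy.le) (fun h => ?_)
    obtain ⟨z, hz, hsl⟩ := exists_hasDerivAt_eq_slope S _ hxy hSc.continuousOn (fun x _ => hSd x)
    rw [h, sub_self, zero_div] at hsl
    have := hA0 z hsl
    have h2 := hB z ⟨hx.1.trans_le (hSm hz.1.le), (hSm hz.2.le).trans_lt (h ▸ hx.2)⟩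
    linarith
  have hsurj : ∀ s, ∃ ξ, (s ∈ Ioo p 1 → S ξ = s) ∧ (s ∉ Ioo p 1 → ξ = 0) := by
    intro s
    by_cases hs : s ∈ Ioo p 1
    · obtain ⟨y, hy1, hy2⟩ := ((hSp.eventually (gt_mem_nhds hs.1)).and (eventually_lt_atBot 0)).exists
      obtain ⟨z, _, hz⟩ := intermediate_value_Icc hy2.le hSc.continuousOn
        (show s ∈ Icc (S y) (S 0) from ⟨hy1.le, by rw [(hend 0 le_rfl).2]; exact hs.2.le⟩)
      exact ⟨z, fun _ => hz, fun h => absurd hs h⟩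
    · exact ⟨0, fun h => absurd h hs, fun _ => rfl⟩
  choose X hX1 hX2 using hsurj
  have hXc : ∀ s ∈ Ioo p 1, ContinuousAt X s := by
    intro s hs
    have hn : ∀ᶠ y in 𝓝 s, y ∈ Ioo p 1 := Ioo_mem_nhds hs.1 hs.2
    rw [ContinuousAt, tendsto_order]
    constructor
    · intro l hl
      have h1 : S l < s := by
        refine lt_of_le_of_ne ((hX1 s hs) ▸ hSm hl.le) (fun h => ?_)
        have := hstrict l (X s) hl (h ▸ hs)
        rw [h, hX1 s hs] at this
        exact lt_irrefl _ this
      filter_upwards [hn, lt_mem_nhds h1] with y hy hy2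
      by_contra hcon
      have := hSm (not_lt.1 hcon)
      rw [hX1 y hy] at this
      linarith
    · intro l hl
      have h1 : s < S l := by
        have := hstrict (X s) l hl ((hX1 s hs).symm ▸ hs)
        rwa [hX1 s hs] at this
      filter_upwards [hn, gt_mem_nhds h1] with y hy hy2
      by_contra hcon
      have := hSm (not_lt.1 hcon)
      rw [hX1 y hy] at this
      linarith
  have hMX : ∀ s ∈ Ioo p 1, 0 < M (X s) := fun s hs => hB _ ((hX1 s hs).symm ▸ hs)
  have hXd : ∀ s ∈ Ioo p 1, HasDerivAt X (v / (gam * f s * M (X s))) s := by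
    intro s hs
    have hfp := Y.f_pos s (Ioo_subset_Icc_self hs)
    have hmp := hMX s hs
    have h1 := hSd (X s)
    rw [hX1 s hs] at h1
    have h2 := HasDerivAt.of_local_left_inverse (f := S) (g := X) (hXc s hs) h1
      (by positivity) (by
        filter_upwards [Ioo_mem_nhds hs.1 hs.2] with y hy using hX1 y hy)
    refine h2.congr_deriv ?_
    field_simp
  have hm0 : ∀ s, s ∉ Ioo p 1 → M (X s) = 0 := fun s hs => by
    rw [hX2 s hs]; exact (hend 0 le_rfl).1
  have hMneg : ∀ ξ, 0 < M ξ → ξ ≤ 0 := by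
    intro ξ h
    by_contra hcon
    rw [(hend ξ (not_le.1 hcon).le).1] at h
    exact lt_irrefl _ h
  refine ⟨fun s => M (X s), X, ?_, hm0 p (fun h => lt_irrefl _ h.1), hm0 1 (fun h => lt_irrefl _ h.2),
    hMX, fun s => (hM _).2, fun s => (hM _).1, ?_, hXd, ?_⟩
  · rw [continuous_iff_continuousAt]
    intro s
    by_cases hs : s ∈ Ioo p 1
    · exact hMc.continuousAt.comp (hXc s hs)
    · have hms := hm0 s hs
      rw [ContinuousAt, hms, tendsto_order]
      constructor
      · intro l hl
        exact Eventually.of_forall (fun y => hl.trans_le (hM _).1)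
      · intro ε hε
        obtain ⟨N, hN⟩ := eventually_atBot.1 (hM0.eventually (gt_mem_nhds hε))
        have hK : IsCompact ({ξ | ε ≤ M ξ}) := by
          refine (isCompact_Icc (a := N) (b := 0)).of_isClosed_subset
            (isClosed_le continuous_const hMc) (fun ξ hξ => ⟨?_, ?_⟩)
          · by_contra hcon
            exact absurd (hN ξ (not_le.1 hcon).le) (not_lt.2 hξ)
          · exact hMneg ξ (hε.trans_le hξ)
        have hI := (hK.image hSc).isClosed
        have hsn : s ∉ S '' {ξ | ε ≤ M ξ} := by
          rintro ⟨ξ, hξ, rfl⟩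
          exact hs (hA ξ (hε.trans_le hξ))
        filter_upwards [hI.isOpen_compl.mem_nhds hsn] with y hy
        by_cases hyI : y ∈ Ioo p 1
        · by_contra hcon
          exact hy ⟨X y, not_lt.1 hcon, hX1 y hyI⟩
        · rw [hm0 y hyI]; exact hε
  · intro s
    by_cases hs : s ∈ Ioo p 1
    · exact hMneg _ (hMX s hs)
    · exact (hX2 s hs).le
  · intro s hs
    obtain ⟨M', h1, h2⟩ := hMd (X s) (hMX s hs)
    rw [hX1 s hs] at h2
    have hfp := Y.f_pos s (Ioo_subset_Icc_self hs)
    have hmp := hMX s hs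
    have hd := hDp _ ⟨hmp, (hM _).2⟩
    have h3 := h1.comp s (hXd s hs)
    have h4 : M' = v / gam * ((1 - s - lam * F s) - gam * M (X s)) / D (M (X s)) := by
      field_simp
      field_simp at h2
      linarith
    refine h3.congr_deriv ?_
    rw [h4]
    field_simp

theorem psi_facts {D : ℝ → ℝ} (hDc : ContinuousOn D (Ico (0:ℝ) 1)) (hDm : MonotoneOn D (Ico (0:ℝ) 1))
    (hDp : ∀ m ∈ Ioo (0:ℝ) 1, 0 < D m) :
    ∃ Ψ : ℝ → ℝ, ContinuousOn Ψ (Ico (0:ℝ) 1) ∧ (∀ m ∈ Ioo (0:ℝ) 1, HasDerivAt Ψ (D m) m) ∧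
      Ψ 0 = 0 ∧ StrictMonoOn Ψ (Ico (0:ℝ) 1) ∧ (∀ m ∈ Ioo (0:ℝ) 1, Ψ m ≤ m * D m) ∧
      (∀ m2 ∈ Ioo (0:ℝ) 1, ∀ m1 ∈ Ioo (0:ℝ) 1, m2 ≤ m1 → D m2 * (m1 - m2) ≤ Ψ m1 - Ψ m2) := by
  obtain ⟨h1, h2⟩ := prim_facts hDc
  refine ⟨_, h1, h2, by simp, ?_, ?_, ?_⟩
  · apply strictMonoOn_of_deriv_pos (convex_Ico 0 1) h1
    rw [interior_Ico]
    intro x hx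
    rw [(h2 x hx).deriv]; exact hDp x hx
  · intro m hm
    obtain ⟨z, hz, hsl⟩ := exists_hasDerivAt_eq_slope (fun m => ∫ x in (0:ℝ)..m, D x) D hm.1
      (h1.mono (fun x hx => ⟨hx.1, hx.2.trans_lt hm.2⟩)) (fun x hx => h2 x ⟨hx.1, hx.2.trans hm.2⟩)
    have h3 : D z ≤ D m := hDm ⟨hz.1.le, hz.2.trans hm.2⟩ ⟨hm.1.le, hm.2⟩ hz.2.le
    have := hm.1
    simp only [intervalIntegral.integral_same, sub_zero] at hsl
    rw [hsl, div_le_iff₀ hm.1] at h3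
    linarith
  · intro m2 hm2 m1 hm1 hle
    rcases hle.eq_or_lt with h | h
    · simp [h]
    obtain ⟨z, hz, hsl⟩ := exists_hasDerivAt_eq_slope (fun m => ∫ x in (0:ℝ)..m, D x) D h
      (h1.mono (fun x hx => ⟨hm2.1.le.trans hx.1, hx.2.trans_lt hm1.2⟩))
      (fun x hx => h2 x ⟨hm2.1.trans hx.1, hx.2.trans hm1.2⟩)
    have h3 : D m2 ≤ D z := hDm ⟨hm2.1.le, hm2.2⟩ ⟨hm2.1.le.trans hz.1.le, hz.2.trans hm1.2⟩ hz.1.le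
    rw [hsl, le_div_iff₀ (by linarith)] at h3
    exact h3

section
variable {p sM gam v : ℝ} {f h h' G D μ Φ Ψ m X : ℝ → ℝ}

theorem prof_L1 (Y : HData p sM gam f h h' G) (hDp : ∀ m ∈ Ioo (0:ℝ) 1, 0 < D m)
    (P : MProf p gam v f h D m X) : ∀ s ∈ Icc p sM, gam * m s ≤ h s := by
  intro s hs
  have hM := Y.sM_mem
  have := cmp_le (φ := fun s => gam * m s - h s) (p := p) (q := sM)
    ((continuousOn_const.mul P.cont.continuousOn).sub (Y.h_cont.mono (Icc_subset_Icc le_rfl hM.2.le)))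
    (fun x hx => ((P.m_deriv x ⟨hx.1, hx.2.trans hM.2⟩).const_mul gam).sub
      (Y.h_deriv x ⟨hx.1, hx.2.trans hM.2⟩)) (by simp [P.at_p, Y.h_p]) (by
      intro x hx hpos
      have hx' : x ∈ Ioo p 1 := ⟨hx.1, hx.2.trans hM.2⟩
      have h1 := Y.h_up x hx' hx.2.le
      have h2 := Y.f_pos x (Ioo_subset_Icc_self hx')
      have h3 := P.pos x hx'
      have h4 := hDp _ ⟨h3, P.lt_one x⟩
      have h5 := Y.gam_pos
      have : (v ^ 2 / gam ^ 2) * (h x - gam * m x) / (f x * D (m x) * m x) ≤ 0 :=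
        div_nonpos_of_nonpos_of_nonneg (mul_nonpos_of_nonneg_of_nonpos (by positivity) (by linarith)) (by positivity)
      nlinarith) s hs
  linarith

theorem prof_L2 (Y : HData p sM gam f h h' G) (hDp : ∀ m ∈ Ioo (0:ℝ) 1, 0 < D m)
    (P : MProf p gam v f h D m X) {r : ℝ} (hr : sM ≤ r) (hr0 : h r ≤ gam * m r) :
    ∀ s ∈ Icc r 1, h s ≤ gam * m s := by
  intro s hs
  have hM := Y.sM_mem
  have := cmp_le (φ := fun s => h s - gam * m s) (p := r) (q := 1)
    ((Y.h_cont.mono (Icc_subset_Icc (hM.1.le.trans hr) le_rfl)).sub (continuousOn_const.mul P.cont.continuousOn))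
    (fun x hx => (Y.h_deriv x ⟨hM.1.trans (hr.trans_lt hx.1), hx.2⟩).sub
      ((P.m_deriv x ⟨hM.1.trans (hr.trans_lt hx.1), hx.2⟩).const_mul gam)) (by simp [hr0]) (by
      intro x hx hpos
      have hx' : x ∈ Ioo p 1 := ⟨hM.1.trans (hr.trans_lt hx.1), hx.2⟩
      have h1 := Y.h_down x hx' (hr.trans hx.1.le)
      have h2 := Y.f_pos x (Ioo_subset_Icc_self hx')
      have h3 := P.pos x hx'
      have h4 := hDp _ ⟨h3, P.lt_one x⟩
      have h5 := Y.gam_pos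
      have : 0 ≤ (v ^ 2 / gam ^ 2) * (h x - gam * m x) / (f x * D (m x) * m x) :=
        div_nonneg (mul_nonneg (by positivity) (by linarith)) (by positivity)
      nlinarith) s hs
  linarith

theorem prof_u (Y : HData p sM gam f h h' G) (hDp : ∀ m ∈ Ioo (0:ℝ) 1, 0 < D m)
    (H : MuData D μ Φ) (P : MProf p gam v f h D m X) :
    Continuous (fun s => Φ (m s)) ∧ Φ (m p) = 0 ∧ Φ (m 1) = 0 ∧
    ∀ s ∈ Ioo p 1, HasDerivAt (fun s => Φ (m s)) ((v ^ 2 / gam ^ 2) * (h s - gam * m s) / f s) s := by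
  refine ⟨H.phi_cont.comp_continuous P.cont (fun x => ⟨P.nonneg x, P.lt_one x⟩),
    by rw [P.at_p, H.phi_zero], by rw [P.at_one, H.phi_zero], fun s hs => ?_⟩
  have h3 := P.pos s hs
  have h1 := (H.phi_deriv _ ⟨h3, P.lt_one s⟩).comp s (P.m_deriv s hs)
  refine h1.congr_deriv ?_
  have h2 := Y.f_pos s (Ioo_subset_Icc_self hs)
  have h4 := hDp _ ⟨h3, P.lt_one s⟩
  have := Y.gam_pos
  field_simp

theorem prof_y (Y : HData p sM gam f h h' G) (hDp : ∀ m ∈ Ioo (0:ℝ) 1, 0 < D m)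
    (hΨc : ContinuousOn Ψ (Ico (0:ℝ) 1)) (hΨd : ∀ m ∈ Ioo (0:ℝ) 1, HasDerivAt Ψ (D m) m)
    (hΨ0 : Ψ 0 = 0) (P : MProf p gam v f h D m X) :
    Continuous (fun s => Ψ (m s)) ∧ Ψ (m p) = 0 ∧ Ψ (m 1) = 0 ∧
    ∀ s ∈ Ioo p 1, HasDerivAt (fun s => Ψ (m s)) ((v ^ 2 / gam ^ 2) * (h s - gam * m s) / (f s * m s)) s := by
  refine ⟨hΨc.comp_continuous P.cont (fun x => ⟨P.nonneg x, P.lt_one x⟩),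
    by rw [P.at_p, hΨ0], by rw [P.at_one, hΨ0], fun s hs => ?_⟩
  have h3 := P.pos s hs
  have h1 := (hΨd _ ⟨h3, P.lt_one s⟩).comp s (P.m_deriv s hs)
  refine h1.congr_deriv ?_
  have h2 := Y.f_pos s (Ioo_subset_Icc_self hs)
  have h4 := hDp _ ⟨h3, P.lt_one s⟩
  have := Y.gam_pos
  field_simp

theorem prof_low (Y : HData p sM gam f h h' G) (hDp : ∀ m ∈ Ioo (0:ℝ) 1, 0 < D m) (hv : 0 < v)
    (hΨc : ContinuousOn Ψ (Ico (0:ℝ) 1)) (hΨd : ∀ m ∈ Ioo (0:ℝ) 1, HasDerivAt Ψ (D m) m)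
    (hΨ0 : Ψ 0 = 0) (hΨm : StrictMonoOn Ψ (Ico (0:ℝ) 1)) (P : MProf p gam v f h D m X)
    {s0 : ℝ} (hs0 : s0 ∈ Ioo p 1) : ∃ k > 0, ∀ s ∈ Ico s0 1, k * (1 - s) ≤ Ψ (m s) := by
  obtain ⟨yc, yp, y1, yd⟩ := prof_y Y hDp hΨc hΨd hΨ0 P
  have hg := Y.gam_pos
  have ypos : ∀ s ∈ Ioo p 1, 0 < Ψ (m s) := by
    intro s hs
    have := hΨm (a := 0) (b := m s) ⟨le_rfl, one_pos⟩ ⟨P.nonneg s, P.lt_one s⟩ (P.pos s hs)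
    rwa [hΨ0] at this
  obtain ⟨C0, hC0, hhle⟩ := Y.h_le
  set c := v ^ 2 / gam ^ 2 with hc
  have hcp : 0 < c := by positivity
  set C := c * C0 * gam / v with hC
  have hCp : 0 < C := by positivity
  have hXm : MonotoneOn X (Ioo p 1) := by
    apply monotoneOn_of_deriv_nonneg (convex_Ioo p 1)
      (fun s hs => (P.X_deriv s hs).continuousAt.continuousWithinAt)
    · rw [interior_Ioo]; exact fun s hs => (P.X_deriv s hs).differentiableAt.differentiableWithinAt
    · rw [interior_Ioo]
      intro x hx
      rw [(P.X_deriv x hx).deriv]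
      have h2 := Y.f_pos x (Ioo_subset_Icc_self hx)
      have h3 := P.pos x hx
      positivity
  set L := sSup (X '' Ioo p 1) with hL
  have hbdd : BddAbove (X '' Ioo p 1) := ⟨0, by rintro _ ⟨s, _, rfl⟩; exact P.X_le s⟩
  have hXL : ∀ s ∈ Ioo p 1, X s ≤ L := fun s hs => le_csSup hbdd ⟨s, hs, rfl⟩
  obtain ⟨_, ⟨s1, hs1, rfl⟩, hs1L⟩ := exists_lt_of_lt_csSup (s := X '' Ioo p 1) ⟨X s0, s0, hs0, rfl⟩
    (show L - c * gam / (2 * C) < L by have : 0 < c * gam / (2 * C) := by positivity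
                                       linarith)
  have hsm : ∀ s ∈ Ico s1 1, c * gam / 2 * (1 - s) ≤ Ψ (m s) := by
    intro s hs
    have hs' : s ∈ Ioo p 1 := ⟨hs1.1.trans_le hs.1, hs.2⟩
    have h1s : 0 < 1 - s := by linarith [hs.2]
    have key : ∀ ρ ∈ Ioo s 1, c * gam * (ρ - s) - C * (1 - s) * (L - X s) ≤ Ψ (m s) := by
      intro ρ hρ
      have han := anti_of (φ := fun x => Ψ (m x) - C * (1 - s) * X x + c * gam * x)
        (φ' := fun x => c * (h x - gam * m x) / (f x * m x) - C * (1 - s) * (v / (gam * f x * m x)) + c * gam * 1)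
        (p := s) (q := ρ) (by
          apply ContinuousOn.add
          · apply ContinuousOn.sub yc.continuousOn
            apply continuousOn_const.mul
            exact fun x hx => (P.X_deriv x ⟨hs'.1.trans_le hx.1, hx.2.trans_lt hρ.2⟩).continuousAt.continuousWithinAt
          · fun_prop) (by
          intro x hx
          have hx' : x ∈ Ioo p 1 := ⟨hs'.1.trans hx.1, hx.2.trans hρ.2⟩
          exact ((yd x hx').sub ((P.X_deriv x hx').const_mul _)).add ((hasDerivAt_id x).const_mul _)) (by
          intro x hx
          have hx' : x ∈ Ioo p 1 := ⟨hs'.1.trans hx.1, hx.2.trans hρ.2⟩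
          have h2 := Y.f_pos x (Ioo_subset_Icc_self hx')
          have h2' := Y.f_le x (Ioo_subset_Icc_self hx')
          have h3 := P.pos x hx'
          have h4 := hhle x (Ioo_subset_Icc_self hx')
          have h5 : C0 * (1 - x) ≤ C0 * (1 - s) := by have := hx.1; gcongr
          have e : c * (h x - gam * m x) / (f x * m x) - C * (1 - s) * (v / (gam * f x * m x)) + c * gam * 1
            = c * ((h x - C0 * (1 - s)) - gam * m x * (1 - f x)) / (f x * m x) := by
            rw [hC]; field_simp; ring
          rw [e]
          apply div_nonpos_of_nonpos_of_nonneg _ (by positivity)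
          apply mul_nonpos_of_nonneg_of_nonpos hcp.le
          have : 0 ≤ gam * m x * (1 - f x) := mul_nonneg (by positivity) (by linarith)
          linarith)
      have h6 := han ⟨le_rfl, hρ.1.le⟩ ⟨hρ.1.le, le_rfl⟩ hρ.1.le
      simp only [] at h6
      have hρ' : ρ ∈ Ioo p 1 := ⟨hs'.1.trans hρ.1, hρ.2⟩
      have h7 := ypos ρ hρ'
      have h8 : C * (1 - s) * X ρ ≤ C * (1 - s) * L := by
        have := hXL ρ hρ'; gcongr
      linarith
    have key2 : c * gam * (1 - s) - C * (1 - s) * (L - X s) ≤ Ψ (m s) := by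
      have ht : Tendsto (fun ρ => c * gam * (ρ - s) - C * (1 - s) * (L - X s)) (𝓝[<] 1)
          (𝓝 (c * gam * (1 - s) - C * (1 - s) * (L - X s))) := by
        apply Tendsto.mono_left _ nhdsWithin_le_nhds
        exact Continuous.tendsto (by fun_prop) 1
      refine le_of_tendsto ht ?_
      filter_upwards [Ioo_mem_nhdsLT hs.2] with ρ hρ using key ρ hρ
    have h9 : X s1 ≤ X s := hXm hs1 hs' hs.1
    have h10 : C * (L - X s) ≤ c * gam / 2 := by
      have : L - X s ≤ c * gam / (2 * C) := by linarith
      calc C * (L - X s) ≤ C * (c * gam / (2 * C)) := by gcongr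
        _ = c * gam / 2 := by field_simp
    nlinarith
  obtain ⟨x0, hx0, hx0m⟩ := (isCompact_Icc (a := s0) (b := max s0 s1)).exists_isMinOn
    (nonempty_Icc.2 (le_max_left _ _)) yc.continuousOn
  have hk := ypos x0 ⟨hs0.1.trans_le hx0.1, hx0.2.trans_lt (max_lt hs0.2 hs1.2)⟩
  refine ⟨min (c * gam / 2) (Ψ (m x0)), lt_min (by positivity) hk, fun s hs => ?_⟩
  have h1s : 0 < 1 - s := by linarith [hs.2]
  rcases le_total s1 s with h | h
  · exact (mul_le_mul_of_nonneg_right (min_le_left _ _) h1s.le).trans (hsm s ⟨h, hs.2⟩)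
  · have h2 : Ψ (m x0) ≤ Ψ (m s) := hx0m ⟨hs.1, h.trans (le_max_right _ _)⟩
    have h3 := min_le_right (c * gam / 2) (Ψ (m x0))
    have h4 : 0 < s := Y.p_pos.trans (hs0.1.trans_le hs.1)
    have h5 : 0 < min (c * gam / 2) (Ψ (m x0)) := lt_min (by positivity) hk
    nlinarith
end

section
variable {p sM gam v1 v2 : ℝ} {f h h' G D μ Φ m1 X1 m2 X2 : ℝ → ℝ}

theorem prof_le (Y : HData p sM gam f h h' G) (hDp : ∀ m ∈ Ioo (0:ℝ) 1, 0 < D m)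
    (hDc : ContinuousOn D (Ico (0:ℝ) 1)) (hDm : MonotoneOn D (Ico (0:ℝ) 1))
    (H : MuData D μ Φ) (hv1 : 0 < v1) (hv : v1 < v2)
    (P1 : MProf p gam v1 f h D m1 X1) (P2 : MProf p gam v2 f h D m2 X2) :
    ∀ s ∈ Ioo p 1, m1 s ≤ m2 s := by
  intro s0 hs0
  by_contra hcon
  push Not at hcon
  have hg := Y.gam_pos
  have hv2 : 0 < v2 := hv1.trans hv
  set c1 := v1 ^ 2 / gam ^ 2 with hc1
  set c2 := v2 ^ 2 / gam ^ 2 with hc2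
  have hc1p : 0 < c1 := by positivity
  have hc2p : 0 < c2 := by positivity
  have hc12 : c1 ≤ c2 := by rw [hc1, hc2]; gcongr
  by_cases hcase : ∀ r ∈ Icc p s0, gam * m1 r ≤ h r
  · obtain ⟨uc1, up1, -, ud1⟩ := prof_u Y hDp H P1
    obtain ⟨uc2, up2, -, ud2⟩ := prof_u Y hDp H P2
    have := cmp_le (φ := fun s => Φ (m1 s) - Φ (m2 s)) (p := p) (q := s0) (uc1.sub uc2).continuousOn
      (fun x hx => (ud1 x ⟨hx.1, hx.2.trans hs0.2⟩).sub (ud2 x ⟨hx.1, hx.2.trans hs0.2⟩))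
      (by simp [up1, up2]) (by
        intro x hx hpos
        have hx' : x ∈ Ioo p 1 := ⟨hx.1, hx.2.trans hs0.2⟩
        have h1 : m2 x < m1 x := (H.phi_mono.lt_iff_lt ⟨P2.nonneg x, P2.lt_one x⟩
          ⟨P1.nonneg x, P1.lt_one x⟩).1 (by linarith)
        have h2 := Y.f_pos x (Ioo_subset_Icc_self hx')
        have h3 := hcase x (Ioo_subset_Icc_self hx)
        rw [← sub_div]
        apply div_nonpos_of_nonpos_of_nonneg _ h2.le
        rw [← hc1, ← hc2, sub_nonpos]
        have h4 : gam * m2 x ≤ gam * m1 x := by gcongr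
        calc c1 * (h x - gam * m1 x) ≤ c2 * (h x - gam * m1 x) :=
              mul_le_mul_of_nonneg_right hc12 (by linarith)
          _ ≤ _ := by gcongr) s0 ⟨hs0.1.le, le_rfl⟩
    have h5 := H.phi_mono ⟨P2.nonneg s0, P2.lt_one s0⟩ ⟨P1.nonneg s0, P1.lt_one s0⟩ hcon
    linarith
  · push Not at hcase
    obtain ⟨r, hr, hr0⟩ := hcase
    have hrM : sM ≤ r := by
      by_contra hlt
      have := prof_L1 Y hDp P1 r ⟨hr.1, (not_le.1 hlt).le⟩
      linarith
    have hneg : ∀ s ∈ Icc s0 1, h s ≤ gam * m1 s := fun s hs =>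
      prof_L2 Y hDp P1 hrM hr0.le s ⟨hr.2.trans hs.1, hs.2⟩
    obtain ⟨Ψ, hΨc, hΨd, hΨ0, hΨm, hΨ1, hΨ2⟩ := psi_facts hDc hDm hDp
    obtain ⟨yc1, -, y11, yd1⟩ := prof_y Y hDp hΨc hΨd hΨ0 P1
    obtain ⟨yc2, -, y21, yd2⟩ := prof_y Y hDp hΨc hΨd hΨ0 P2
    obtain ⟨k, hk, hlow⟩ := prof_low Y hDp hv2 hΨc hΨd hΨ0 hΨm P2 hs0
    obtain ⟨C0, hC0, hhle⟩ := Y.h_le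
    set e : ℝ → ℝ := fun s => Ψ (m1 s) - Ψ (m2 s) with he
    have hec : Continuous e := yc1.sub yc2
    set e' : ℝ → ℝ := fun s => c1 * (h s - gam * m1 s) / (f s * m1 s) -
      c2 * (h s - gam * m2 s) / (f s * m2 s) with he'
    have hed : ∀ s ∈ Ioo p 1, HasDerivAt e (e' s) s := fun s hs => (yd1 s hs).sub (yd2 s hs)
    have hsub : ∀ s ∈ Ioo s0 1, s ∈ Ioo p 1 := fun s hs => ⟨hs0.1.trans hs.1, hs.2⟩
    have he'low : ∀ s ∈ Ioo s0 1, c2 * h s / f s * (1 / m1 s - 1 / m2 s) ≤ e' s := by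
      intro s hs
      have h1 := Y.f_pos s (Ioo_subset_Icc_self (hsub s hs))
      have h2 := P1.pos s (hsub s hs)
      have h3 := P2.pos s (hsub s hs)
      have h4 := hneg s (Ioo_subset_Icc_self hs)
      have e1 : e' s - c2 * h s / f s * (1 / m1 s - 1 / m2 s) =
          (c2 - c1) * (gam * m1 s - h s) / (f s * m1 s) := by
        simp only [he']; field_simp; ring
      have : 0 ≤ (c2 - c1) * (gam * m1 s - h s) / (f s * m1 s) :=
        div_nonneg (mul_nonneg (by linarith) (by linarith)) (by positivity)
      linarith
    have hepos0 : 0 < e s0 := by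
      have := hΨm ⟨P2.nonneg s0, P2.lt_one s0⟩ ⟨P1.nonneg s0, P1.lt_one s0⟩ hcon
      simp only [he]; linarith
    have henn : ∀ s ∈ Icc s0 1, 0 ≤ e s := by
      intro s hs
      have := cmp_le (φ := fun s => - e s) (p := s0) (q := 1) hec.neg.continuousOn
        (fun x hx => (hed x (hsub x hx)).neg) (by simp [hepos0.le]) (by
          intro x hx hpos
          have h2 := P1.pos x (hsub x hx)
          have h3 := P2.pos x (hsub x hx)
          have h1 : m1 x < m2 x := (hΨm.lt_iff_lt ⟨P1.nonneg x, P1.lt_one x⟩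
            ⟨P2.nonneg x, P2.lt_one x⟩).1 (by simp only [he] at hpos; linarith)
          have h4 := one_div_le_one_div_of_le h2 h1.le
          have h5 := Y.f_pos x (Ioo_subset_Icc_self (hsub x hx))
          have h6 := Y.h_pos x (hsub x hx)
          have h7 : 0 ≤ c2 * h x / f x * (1 / m1 x - 1 / m2 x) := mul_nonneg (by positivity) (by linarith)
          linarith [he'low x hx]) s hs
      linarith
    set K := c2 * C0 * gam / (k * v1) with hK
    have hKp : 0 < K := by positivity
    have he'low2 : ∀ s ∈ Ioo s0 1, - (K * (v1 / (gam * f s * m1 s)) * e s) ≤ e' s := by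
      intro s hs
      have hs' := hsub s hs
      have h1 := Y.f_pos s (Ioo_subset_Icc_self hs')
      have h2 := P1.pos s hs'
      have h3 := P2.pos s hs'
      have h4 := henn s (Ioo_subset_Icc_self hs)
      have hle : m2 s ≤ m1 s := (hΨm.le_iff_le ⟨P2.nonneg s, P2.lt_one s⟩
            ⟨P1.nonneg s, P1.lt_one s⟩).1 (by simp only [he] at h4; linarith)
      have h5 : D (m2 s) * (m1 s - m2 s) ≤ e s := hΨ2 _ ⟨h3, P2.lt_one s⟩ _ ⟨h2, P1.lt_one s⟩ hle
      have h6 := hΨ1 _ ⟨h3, P2.lt_one s⟩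
      have h7 := hlow s ⟨hs.1.le, hs.2⟩
      have h8 := hhle s (Ioo_subset_Icc_self hs')
      have h9 := he'low s hs
      have hd := hDp _ ⟨h3, P2.lt_one s⟩
      have h10 := Y.h_pos s hs'
      -- k h ≤ C0 m2 D
      have h11 : k * h s ≤ C0 * (m2 s * D (m2 s)) := by
        calc k * h s ≤ k * (C0 * (1 - s)) := by gcongr
          _ = C0 * (k * (1 - s)) := by ring
          _ ≤ _ := mul_le_mul_of_nonneg_left (h7.trans h6) hC0.le
      have h12 : k * h s * (m1 s - m2 s) ≤ C0 * m2 s * e s := by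
        calc k * h s * (m1 s - m2 s) ≤ C0 * (m2 s * D (m2 s)) * (m1 s - m2 s) :=
              mul_le_mul_of_nonneg_right h11 (by linarith)
          _ = C0 * m2 s * (D (m2 s) * (m1 s - m2 s)) := by ring
          _ ≤ _ := by gcongr
      refine le_trans ?_ h9
      have e1 : c2 * h s / f s * (1 / m1 s - 1 / m2 s) + K * (v1 / (gam * f s * m1 s)) * e s =
          c2 / (k * f s * m1 s * m2 s) * (C0 * m2 s * e s - k * h s * (m1 s - m2 s)) := by
        rw [hK]; field_simp; ring
      have : 0 ≤ c2 / (k * f s * m1 s * m2 s) * (C0 * m2 s * e s - k * h s * (m1 s - m2 s)) :=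
        mul_nonneg (by positivity) (by linarith)
      linarith
    set e0 := e s0 * Real.exp (K * X1 s0) with he0
    have he0p : 0 < e0 := by positivity
    have hge : ∀ s ∈ Ioo s0 1, e0 ≤ e s := by
      intro s hs
      have han := anti_of (φ := fun x => - (e x * Real.exp (K * X1 x))) (p := s0) (q := s)
        (by
          apply ContinuousOn.neg
          apply hec.continuousOn.mul
          apply Real.continuous_exp.comp_continuousOn
          apply continuousOn_const.mul
          exact fun x hx => (P1.X_deriv x ⟨hs0.1.trans_le hx.1, hx.2.trans_lt hs.2⟩).continuousAt.continuousWithinAt)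
        (fun x hx => by
          have hx' : x ∈ Ioo s0 1 := ⟨hx.1, hx.2.trans hs.2⟩
          exact ((hed x (hsub x hx')).mul (((P1.X_deriv x (hsub x hx')).const_mul K).exp)).neg)
        (fun x hx => by
          have hx' : x ∈ Ioo s0 1 := ⟨hx.1, hx.2.trans hs.2⟩
          have h1 := he'low2 x hx'
          have h2 := Real.exp_pos (K * X1 x)
          have : 0 ≤ (e' x + K * (v1 / (gam * f x * m1 x)) * e x) * Real.exp (K * X1 x) :=
            mul_nonneg (by linarith) h2.le
          linarith)
      have h1 := han ⟨le_rfl, hs.1.le⟩ ⟨hs.1.le, le_rfl⟩ hs.1.le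
      simp only [] at h1
      have h2 : Real.exp (K * X1 s) ≤ 1 := by
        rw [Real.exp_le_one_iff]
        exact mul_nonpos_of_nonneg_of_nonpos hKp.le (P1.X_le s)
      have h3 := henn s (Ioo_subset_Icc_self hs)
      have h4 : e s * Real.exp (K * X1 s) ≤ e s * 1 := by gcongr
      rw [he0]; linarith
    have ht : Tendsto e (𝓝[<] 1) (𝓝 (e 1)) := hec.continuousAt.tendsto.mono_left nhdsWithin_le_nhds
    have hfin : e0 ≤ e 1 := by
      refine ge_of_tendsto ht ?_
      filter_upwards [Ioo_mem_nhdsLT hs0.2] with ρ hρ using hge ρ hρ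
    have : e 1 = 0 := by simp only [he, y11, y21, sub_zero]
    linarith

theorem prof_unique (Y : HData p sM gam f h h' G) (hDp : ∀ m ∈ Ioo (0:ℝ) 1, 0 < D m)
    (hDc : ContinuousOn D (Ico (0:ℝ) 1)) (hDm : MonotoneOn D (Ico (0:ℝ) 1))
    (H : MuData D μ Φ) (hv1 : 0 < v1) (hv : v1 < v2)
    (P1 : MProf p gam v1 f h D m1 X1) (P2 : MProf p gam v2 f h D m2 X2) : False := by
  have hle := prof_le Y hDp hDc hDm H hv1 hv P1 P2
  have hg := Y.gam_pos
  have hv2 : 0 < v2 := hv1.trans hv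
  obtain ⟨uc1, up1, u11, ud1⟩ := prof_u Y hDp H P1
  obtain ⟨uc2, up2, u21, ud2⟩ := prof_u Y hDp H P2
  set c1 := v1 ^ 2 / gam ^ 2 with hc1
  set c2 := v2 ^ 2 / gam ^ 2 with hc2
  have hc1p : 0 < c1 := by positivity
  have hc2p : 0 < c2 := by positivity
  have hc12 : c1 < c2 := by rw [hc1, hc2]; gcongr
  set φ : ℝ → ℝ := fun s => Φ (m2 s) / c2 - Φ (m1 s) / c1 with hφ
  have hφd : ∀ s ∈ Ioo p 1, HasDerivAt φ (gam * (m1 s - m2 s) / f s) s := by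
    intro s hs
    have hf := Y.f_pos s (Ioo_subset_Icc_self hs)
    refine (((ud2 s hs).div_const c2).sub ((ud1 s hs).div_const c1)).congr_deriv ?_
    field_simp
    ring
  have han := anti_of (φ := φ) (p := p) (q := 1)
    ((uc2.div_const _).sub (uc1.div_const _)).continuousOn hφd (by
      intro x hx
      have hf := Y.f_pos x (Ioo_subset_Icc_self hx)
      apply div_nonpos_of_nonpos_of_nonneg _ hf.le
      exact mul_nonpos_of_nonneg_of_nonpos hg.le (by linarith [hle x hx]))
  have hφ0 : ∀ s ∈ Icc p 1, φ s = 0 := by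
    intro s hs
    have h1 := han ⟨le_rfl, Y.p_lt.le⟩ hs hs.1
    have h2 := han hs ⟨Y.p_lt.le, le_rfl⟩ hs.2
    have h3 : φ p = 0 := by simp only [hφ, up1, up2]; simp
    have h4 : φ 1 = 0 := by simp only [hφ, u11, u21]; simp
    rw [h3] at h1; rw [h4] at h2
    exact le_antisymm h1 h2
  have hM := Y.sM_mem
  have hd0 : HasDerivAt φ 0 sM := by
    refine (hasDerivAt_const sM (0:ℝ)).congr_of_eventuallyEq ?_
    filter_upwards [Ioo_mem_nhds hM.1 hM.2] with y hy using hφ0 y (Ioo_subset_Icc_self hy)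
  have hu := hd0.unique (hφd sM hM)
  have hf := Y.f_pos sM (Ioo_subset_Icc_self hM)
  have hmm : m1 sM = m2 sM := by
    rw [eq_comm, div_eq_zero_iff] at hu
    rcases hu with hu | hu
    · rcases mul_eq_zero.1 hu with hu | hu
      · exact absurd hu hg.ne'
      · linarith
    · exact absurd hu hf.ne'
  have hz := hφ0 sM (Ioo_subset_Icc_self hM)
  simp only [hφ, hmm] at hz
  have hΦ : 0 < Φ (m2 sM) := by
    have := H.phi_mono (a := 0) (b := m2 sM) ⟨le_rfl, one_pos⟩ ⟨P2.nonneg _, P2.lt_one _⟩ (P2.pos _ hM)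
    rwa [H.phi_zero] at this
  have : Φ (m2 sM) / c2 < Φ (m2 sM) / c1 := by gcongr
  linarith
end

theorem primL {E Q : ℝ → ℝ} (hE : ContinuousOn E (Ioc (0:ℝ) 1))
    (hQ : ∀ s ∈ Ioc (0:ℝ) 1, Q s = ∫ ρ in s..1, E ρ) :
    ContinuousOn Q (Ioc (0:ℝ) 1) ∧ ∀ s ∈ Ioo (0:ℝ) 1, HasDerivAt Q (- E s) s := by
  have hint : ∀ s ∈ Ioc (0:ℝ) 1, IntervalIntegrable E MeasureTheory.volume s 1 := by
    intro s hs
    apply ContinuousOn.intervalIntegrable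
    rw [uIcc_of_le hs.2]
    exact hE.mono (fun x hx => ⟨hs.1.trans_le hx.1, hx.2⟩)
  constructor
  · intro s hs
    have h1 : ContinuousOn (fun x => ∫ t in x..1, E t) (uIcc (s / 2) 1) := by
      apply intervalIntegral.continuousOn_primitive_interval_left
      rw [uIcc_of_le (by linarith [hs.2, hs.1])]
      apply ContinuousOn.integrableOn_Icc
      exact hE.mono (fun x hx => ⟨by linarith [hs.1, hx.1], hx.2⟩)
    rw [uIcc_of_le (by linarith [hs.2, hs.1])] at h1
    have h2 := h1 s ⟨by linarith [hs.1], hs.2⟩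
    have h3 : ContinuousWithinAt (fun x => ∫ t in x..1, E t) (Ioc 0 1) s := by
      apply h2.mono_of_mem_nhdsWithin
      have : Ioi (s / 2) ∈ 𝓝[Ioc 0 1] s := nhdsWithin_le_nhds (Ioi_mem_nhds (by linarith [hs.1]))
      filter_upwards [this, self_mem_nhdsWithin] with x hx hx2
      exact ⟨le_of_lt hx, hx2.2⟩
    exact h3.congr (fun y hy => hQ y hy) (hQ s hs)
  · intro s hs
    have hn : Ioo (0:ℝ) 1 ∈ 𝓝 s := Ioo_mem_nhds hs.1 hs.2
    have hE' := hE.mono Ioo_subset_Ioc_self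
    have h1 : HasDerivAt (fun x => ∫ t in x..1, E t) (- E s) s := by
      refine intervalIntegral.integral_hasDerivAt_left (hint s (Ioo_subset_Ioc_self hs)) ?_ (hE'.continuousAt hn)
      exact hE'.stronglyMeasurableAtFilter_nhdsWithin measurableSet_Ioo s |>.filter_mono (by
        rw [nhdsWithin_eq_nhds.2 hn])
    refine h1.congr_of_eventuallyEq ?_
    filter_upwards [hn] with y hy using hQ y (Ioo_subset_Ioc_self hy)

theorem D_div {D : ℝ → ℝ} {b LD1 : ℝ} (hb : 1 < b) (hLD1 : 0 < LD1)
    (hDc : ContinuousOn D (Ico (0:ℝ) 1)) (hDn : ∀ m ∈ Ico (0:ℝ) 1, 0 ≤ D m)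
    (hD_one : Filter.Tendsto (fun m => (1 - m) ^ b * D m) (nhdsWithin 1 (Set.Iio 1)) (nhds LD1)) :
    ∀ R : ℝ, ∃ m ∈ Ico (0:ℝ) 1, R ≤ ∫ x in (0:ℝ)..m, D x * x := by
  intro R
  obtain ⟨hc, hd⟩ := prim_facts (E := fun x => D x * x) (hDc.mul continuousOn_id)
  set P : ℝ → ℝ := fun m => ∫ x in (0:ℝ)..m, D x * x with hP
  have hev := hD_one.eventually (lt_mem_nhds (show LD1 / 2 < LD1 by linarith))
  obtain ⟨l, hl, hl2⟩ := (mem_nhdsLT_iff_exists_Ioo_subset (a := (1:ℝ))).1 hev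
  have hl : l < 1 := hl
  set m0 := max l (1 / 2) with hm0
  have hm01 : m0 < 1 := max_lt hl (by norm_num)
  have hm0h : 1 / 2 ≤ m0 := le_max_right _ _
  have hlow : ∀ x ∈ Ioo m0 1, LD1 / 4 / (1 - x) ≤ D x * x := by
    intro x hx
    have h1 : LD1 / 2 < (1 - x) ^ b * D x := hl2 ⟨(le_max_left _ _).trans_lt hx.1, hx.2⟩
    have h1x : 0 < 1 - x := by linarith [hx.2]
    have hx2 : 1 / 2 < x := by linarith [hx.1]
    have h2 : (1 - x) ^ b ≤ 1 - x := by
      have := Real.rpow_le_rpow_of_exponent_ge h1x (by linarith) hb.le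
      rwa [Real.rpow_one] at this
    have hD := hDn x ⟨by linarith, hx.2⟩
    have h3 : LD1 / 2 ≤ (1 - x) * D x := h1.le.trans (mul_le_mul_of_nonneg_right h2 hD)
    rw [div_le_iff₀ h1x]
    have h4 : 0 ≤ (1 - x) * D x := by positivity
    nlinarith
  set T := max (- Real.log (1 - m0)) ((R - P m0 - LD1 / 4 * Real.log (1 - m0)) / (LD1 / 4)) with hT
  have hm1 : 0 < 1 - m0 := by linarith
  have hmm : m0 ≤ 1 - Real.exp (-T) := by
    have : Real.exp (-T) ≤ 1 - m0 := by
      rw [← Real.exp_log hm1]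
      apply Real.exp_le_exp.2
      have := le_max_left (- Real.log (1 - m0)) ((R - P m0 - LD1 / 4 * Real.log (1 - m0)) / (LD1 / 4))
      linarith
    linarith
  have hml : 1 - Real.exp (-T) < 1 := by linarith [Real.exp_pos (-T)]
  refine ⟨1 - Real.exp (-T), ⟨by linarith, hml⟩, ?_⟩
  have han := anti_of (φ := fun x => - (P x + LD1 / 4 * Real.log (1 - x)))
    (φ' := fun x => - (D x * x + LD1 / 4 * ((-1) / (1 - x)))) (p := m0) (q := 1 - Real.exp (-T)) (by
      apply ContinuousOn.neg
      apply ContinuousOn.add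
      · exact hc.mono (fun x hx => ⟨by linarith [hx.1], hx.2.trans_lt hml⟩)
      · apply continuousOn_const.mul
        apply ContinuousOn.log (by fun_prop)
        intro x hx
        have := hx.2.trans_lt hml
        linarith) (by
      intro x hx
      have hx1 := hx.2.trans hml
      refine ((hd x ⟨by linarith [hx.1], hx1⟩).add (HasDerivAt.const_mul _ ?_)).neg
      exact ((hasDerivAt_id x).const_sub 1).log (by simp only [id]; linarith)) (by
      intro x hx
      have hx1 := hx.2.trans hml
      have := hlow x ⟨hx.1, hx1⟩
      have e : LD1 / 4 * ((-1) / (1 - x)) = - (LD1 / 4 / (1 - x)) := by ring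
      rw [e]; linarith)
  have h1 := han ⟨le_rfl, hmm⟩ ⟨hmm, le_rfl⟩ hmm
  simp only [sub_sub_cancel, Real.log_exp] at h1
  have h2 := le_max_right (- Real.log (1 - m0)) ((R - P m0 - LD1 / 4 * Real.log (1 - m0)) / (LD1 / 4))
  rw [← hT, div_le_iff₀ (by linarith)] at h2
  change R ≤ P (1 - Real.exp (-T))
  linarith

theorem tw_main
    (lam gam kap : ℝ)
    (hlam : lam ∈ Set.Ioo (0:ℝ) 1) (hgam : gam ∈ Set.Ioo (0:ℝ) 1)
    (hkap : kap ∈ Set.Ioc (0:ℝ) 1)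
    (f f' F : ℝ → ℝ)
    (hf_maps : ∀ x ∈ Set.Icc (0:ℝ) 1, f x ∈ Set.Icc (0:ℝ) 1)
    (hf_mono : StrictMonoOn f (Set.Icc (0:ℝ) 1))
    (hf_deriv : ∀ x ∈ Set.Icc (0:ℝ) 1, HasDerivWithinAt f (f' x) (Set.Icc (0:ℝ) 1) x)
    (hf'_cont : ContinuousOn f' (Set.Icc (0:ℝ) 1))
    (hf_zero : f 0 = 0) (hf'_zero : f' 0 = 1 / kap)
    (hf_one : f 1 ∈ Set.Ioc lam 1)
    (hF : ∀ s ∈ Set.Ioc (0:ℝ) 1, F s = ∫ ρ in s..1, 1 / f ρ)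
    (D : ℝ → ℝ) (a b : ℝ) (ha : 1 < a) (hb : 1 < b)
    (hD_mono : MonotoneOn D (Set.Ico (0:ℝ) 1))
    (hD_nonneg : ∀ m ∈ Set.Ico (0:ℝ) 1, 0 ≤ D m)
    (hD_smooth : ∃ D' : ℝ → ℝ, ContinuousOn D' (Set.Ico (0:ℝ) 1) ∧
      ∀ m ∈ Set.Ico (0:ℝ) 1, HasDerivWithinAt D (D' m) (Set.Ico (0:ℝ) 1) m)
    (LD0 LD1 : ℝ) (hLD0 : 0 < LD0) (hLD1 : 0 < LD1)
    (hD_zero : Filter.Tendsto (fun m => D m / m ^ a) (nhdsWithin 0 (Set.Ioi 0)) (nhds LD0))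
    (hD_one : Filter.Tendsto (fun m => (1 - m) ^ b * D m) (nhdsWithin 1 (Set.Iio 1)) (nhds LD1))
    (sInf : ℝ) (hsInf_mem : sInf ∈ Set.Ioo (0:ℝ) 1)
    (hsInf_eq : sInf + lam * F sInf = 1)
    (sM : ℝ) (hsM_mem : sM ∈ Set.Ioo (0:ℝ) 1) (hsM_eq : f sM = lam)
    (hpar : sM + lam * F sM < 1 - gam)
    (G : ℝ → ℝ)
    (hG : ∀ s ∈ Set.Ioc (0:ℝ) 1, G s = ∫ ρ in s..1, (ρ + lam * F ρ - (1 - gam)) / f ρ)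
    (hGpos : ∀ s ∈ Set.Ioo sInf 1, 0 < G s) :
    ∃! v : ℝ, 0 < v ∧ ∃ M S : ℝ → ℝ, IsTW lam gam v sInf f F D M S := by
  have hp := hsInf_mem
  have hfc : ContinuousOn f (Icc 0 1) := fun x hx => (hf_deriv x hx).continuousWithinAt
  have hf0 : ∀ s ∈ Ioc (0:ℝ) 1, 0 < f s := by
    intro s hs
    have := hf_mono (a := 0) (b := s) ⟨le_rfl, zero_le_one⟩ (Ioc_subset_Icc_self hs) hs.1
    rwa [hf_zero] at this
  have hfc' := hfc.mono Ioc_subset_Icc_self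
  obtain ⟨hFc, hFd⟩ := primL (E := fun ρ => 1 / f ρ)
    (continuousOn_const.div hfc' (fun x hx => (hf0 x hx).ne')) hF
  obtain ⟨hGc, hGd⟩ := primL (E := fun ρ => (ρ + lam * F ρ - (1 - gam)) / f ρ)
    (((continuousOn_id.add (continuousOn_const.mul hFc)).sub continuousOn_const).div hfc'
      (fun x hx => (hf0 x hx).ne')) hG
  have hF1 : F 1 = 0 := by rw [hF 1 ⟨one_pos, le_rfl⟩]; simp
  have hFn : ∀ s ∈ Ioc (0:ℝ) 1, 0 ≤ F s := by
    intro s hs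
    rw [hF s hs]
    exact intervalIntegral.integral_nonneg hs.2 (fun u hu =>
      (one_div_pos.2 (hf0 u ⟨hs.1.trans_le hu.1, hu.2⟩)).le)
  set h : ℝ → ℝ := fun s => 1 - s - lam * F s with hh
  have hhc : ContinuousOn h (Ioc 0 1) :=
    (continuousOn_const.sub continuousOn_id).sub (continuousOn_const.mul hFc)
  have hhd : ∀ s ∈ Ioo (0:ℝ) 1, HasDerivAt h (-1 + lam / f s) s := by
    intro s hs
    refine (((hasDerivAt_id s).const_sub 1).sub ((hFd s hs).const_mul lam)).congr_deriv ?_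
    ring
  have hmono : StrictMonoOn h (Ioc 0 sM) := by
    apply strictMonoOn_of_deriv_pos (convex_Ioc 0 sM)
      (hhc.mono (Ioc_subset_Ioc le_rfl hsM_mem.2.le))
    rw [interior_Ioc]
    intro x hx
    have hx' : x ∈ Ioo (0:ℝ) 1 := ⟨hx.1, hx.2.trans hsM_mem.2⟩
    rw [(hhd x hx').deriv]
    have h1 := hf_mono (Ioo_subset_Icc_self hx') (Ioo_subset_Icc_self hsM_mem) hx.2
    rw [hsM_eq] at h1
    have := (one_lt_div (hf0 x (Ioo_subset_Ioc_self hx'))).2 h1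
    linarith
  have hanti : StrictAntiOn h (Icc sM 1) := by
    apply strictAntiOn_of_deriv_neg (convex_Icc sM 1)
      (hhc.mono (fun x hx => ⟨hsM_mem.1.trans_le hx.1, hx.2⟩))
    rw [interior_Icc]
    intro x hx
    have hx' : x ∈ Ioo (0:ℝ) 1 := ⟨hsM_mem.1.trans hx.1, hx.2⟩
    rw [(hhd x hx').deriv]
    have h1 := hf_mono (Ioo_subset_Icc_self hsM_mem) (Ioo_subset_Icc_self hx') hx.1
    rw [hsM_eq] at h1
    have := (div_lt_one (hf0 x (Ioo_subset_Ioc_self hx'))).2 h1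
    linarith
  have h1 : h 1 = 0 := by simp [hh, hF1]
  have hpz : h sInf = 0 := by simp only [hh]; linarith
  have hpM : sInf < sM := by
    by_contra hcon
    have := hanti ⟨not_lt.1 hcon, hp.2.le⟩ ⟨hsM_mem.2.le, le_rfl⟩ hp.2
    rw [h1, hpz] at this
    exact lt_irrefl _ this
  have hsub : ∀ s ∈ Icc sInf 1, s ∈ Ioc (0:ℝ) 1 := fun s hs => ⟨hp.1.trans_le hs.1, hs.2⟩
  have hsub' : ∀ s ∈ Ioo sInf 1, s ∈ Ioo (0:ℝ) 1 := fun s hs => ⟨hp.1.trans hs.1, hs.2⟩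
  have hGd' : ∀ s ∈ Ioo sInf 1, HasDerivAt G ((h s - gam) / f s) s := by
    intro s hs
    refine (hGd s (hsub' s hs)).congr_deriv ?_
    simp only [hh]
    ring
  have hGc' : ContinuousOn G (Icc sInf 1) := hGc.mono hsub
  have hGp : 0 < G sInf := by
    have hca : ContinuousAt h sInf := (hhd sInf hp).continuousAt
    have hev : ∀ᶠ x in 𝓝 sInf, h x < gam := hca.eventually (gt_mem_nhds (by rw [hpz]; exact hgam.1))
    have hev' : ∀ᶠ x in 𝓝[>] sInf, h x < gam := nhdsWithin_le_nhds hev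
    obtain ⟨r, hr, hr2⟩ := (mem_nhdsGT_iff_exists_Ioo_subset (a := sInf)).1 hev'
    have hr : sInf < r := hr
    obtain ⟨r', hr1, hr3⟩ := exists_between (lt_min hr hp.2)
    have hr1' : r' < 1 := hr3.trans_le (min_le_right _ _)
    have han := anti_of (φ := G) (p := sInf) (q := r') (hGc'.mono (Icc_subset_Icc le_rfl hr1'.le))
      (fun x hx => hGd' x ⟨hx.1, hx.2.trans hr1'⟩) (by
        intro x hx
        have h2 : h x < gam := hr2 ⟨hx.1, hx.2.trans (hr3.trans_le (min_le_left _ _))⟩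
        exact div_nonpos_of_nonpos_of_nonneg (by linarith) (hf0 x ⟨hp.1.trans hx.1, (hx.2.trans hr1').le⟩).le)
    have := han ⟨le_rfl, hr1.le⟩ ⟨hr1.le, le_rfl⟩ hr1.le
    exact (hGpos r' ⟨hr1, hr1'⟩).trans_le this
  have Y : HData sInf sM gam f (fun s => 1 - s - lam * F s) (fun s => -1 + lam / f s) G :=
    { p_pos := hp.1
      p_lt := hp.2
      gam_pos := hgam.1
      f_cont := hfc.mono (fun x hx => Ioc_subset_Icc_self (hsub x hx))
      f_pos := fun s hs => hf0 s (hsub s hs)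
      f_le := fun s hs => (hf_maps s (Ioc_subset_Icc_self (hsub s hs))).2
      h_cont := hhc.mono hsub
      h_p := hpz
      h_one := h1
      h_pos := by
        intro s hs
        change 0 < h s
        rcases le_total s sM with hle | hle
        · have := hmono ⟨hp.1, hpM.le⟩ ⟨(hsub' s hs).1, hle⟩ hs.1
          rwa [hpz] at this
        · have := hanti ⟨hle, hs.2.le⟩ ⟨hsM_mem.2.le, le_rfl⟩ hs.2
          rwa [h1] at this
      h_le := ⟨1, one_pos, fun s hs => by
        have := mul_nonneg hlam.1.le (hFn s (hsub s hs))
        linarith⟩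
      G_cont := hGc'
      G_deriv := hGd'
      G_one := by rw [hG 1 ⟨one_pos, le_rfl⟩]; simp
      G_pos := by
        intro s hs
        rcases hs.1.eq_or_lt with h2 | h2
        · rw [← h2]; exact hGp
        · exact hGpos s ⟨h2, hs.2⟩
      sM_mem := ⟨hpM, hsM_mem.2⟩
      h_deriv := fun s hs => hhd s (hsub' s hs)
      h_up := by
        intro s hs hle
        have h2 := hf_mono.monotoneOn (Ioo_subset_Icc_self (hsub' s hs)) (Ioo_subset_Icc_self hsM_mem) hle
        rw [hsM_eq] at h2
        have := (one_le_div (hf0 s (Ioo_subset_Ioc_self (hsub' s hs)))).2 h2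
        linarith
      h_down := by
        intro s hs hle
        have h2 := hf_mono.monotoneOn (Ioo_subset_Icc_self hsM_mem) (Ioo_subset_Icc_self (hsub' s hs)) hle
        rw [hsM_eq] at h2
        have := (div_le_one (hf0 s (Ioo_subset_Ioc_self (hsub' s hs)))).2 h2
        linarith
      h_sM := by linarith }
  have hDc : ContinuousOn D (Ico (0:ℝ) 1) := by
    obtain ⟨D', _, hD'⟩ := hD_smooth
    exact fun x hx => (hD' x hx).continuousWithinAt
  have hDp : ∀ m ∈ Ioo (0:ℝ) 1, 0 < D m := by
    intro m hm
    obtain ⟨x, hx1, hx2⟩ := ((hD_zero.eventually (lt_mem_nhds hLD0)).and (Ioo_mem_nhdsGT hm.1)).exists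
    have hxa : 0 < x ^ a := Real.rpow_pos_of_pos hx2.1 a
    have h2 : 0 < D x := by
      have := mul_pos hx1 hxa
      rwa [div_mul_cancel₀ _ hxa.ne'] at this
    exact h2.trans_le (hD_mono ⟨hx2.1.le, hx2.2.trans hm.2⟩ ⟨hm.1.le, hm.2⟩ hx2.2.le)
  obtain ⟨m1, hm1, hm1', hDle⟩ : ∃ m1 : ℝ, 0 < m1 ∧ m1 < 1 ∧ ∀ m ∈ Ioo 0 m1, D m ≤ (LD0 + 1) * m ^ a := by
    obtain ⟨r, hr, hr2⟩ := (mem_nhdsGT_iff_exists_Ioo_subset (a := (0:ℝ))).1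
      (hD_zero.eventually (gt_mem_nhds (show LD0 < LD0 + 1 by linarith)))
    have hr : 0 < r := hr
    refine ⟨min r (1 / 2), lt_min hr (by norm_num), (min_le_right _ _).trans_lt (by norm_num), ?_⟩
    intro m hm
    have h2 : D m / m ^ a < LD0 + 1 := hr2 ⟨hm.1, hm.2.trans_le (min_le_left _ _)⟩
    rw [div_lt_iff₀ (Real.rpow_pos_of_pos hm.1 a)] at h2
    exact h2.le
  obtain ⟨μ, Φ, H⟩ := exists_mu hDc hD_mono hDp (D_div hb hLD1 hDc hD_nonneg hD_one)
  obtain ⟨v, hv, M, S, hT⟩ := tw_exists Y H hDp ha (show 0 < LD0 + 1 by linarith) hm1 hm1' hDle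
  refine ⟨v, ⟨hv, M, S, hT⟩, ?_⟩
  rintro v' ⟨hv', M', S', hT'⟩
  obtain ⟨n1, X1, P1⟩ := tw_profile Y hDp hf0 hv hT
  obtain ⟨n2, X2, P2⟩ := tw_profile Y hDp hf0 hv' hT'
  rcases lt_trichotomy v' v with hlt | heq | hlt
  · exact (prof_unique Y hDp hDc hD_mono H hv' hlt P2 P1).elim
  · exact heq
  · exact (prof_unique Y hDp hDc hD_mono H hv hlt P1 P2).elim

end TWHelpers

theorem travelling_wave_exists_unique
    (lam gam kap : ℝ)
    (hlam : lam ∈ Set.Ioo (0:ℝ) 1) (hgam : gam ∈ Set.Ioo (0:ℝ) 1)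
    (hkap : kap ∈ Set.Ioc (0:ℝ) 1)
    (f f' F : ℝ → ℝ)
    (hf_maps : ∀ x ∈ Set.Icc (0:ℝ) 1, f x ∈ Set.Icc (0:ℝ) 1)
    (hf_mono : StrictMonoOn f (Set.Icc (0:ℝ) 1))
    (hf_deriv : ∀ x ∈ Set.Icc (0:ℝ) 1, HasDerivWithinAt f (f' x) (Set.Icc (0:ℝ) 1) x)
    (hf'_cont : ContinuousOn f' (Set.Icc (0:ℝ) 1))
    (hf_zero : f 0 = 0) (hf'_zero : f' 0 = 1 / kap)
    (hf_one : f 1 ∈ Set.Ioc lam 1)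
    (hF : ∀ s ∈ Set.Ioc (0:ℝ) 1, F s = ∫ ρ in s..1, 1 / f ρ)
    (D : ℝ → ℝ) (a b : ℝ) (ha : 1 < a) (hb : 1 < b)
    (hD_mono : MonotoneOn D (Set.Ico (0:ℝ) 1))
    (hD_nonneg : ∀ m ∈ Set.Ico (0:ℝ) 1, 0 ≤ D m)
    (hD_smooth : ∃ D' : ℝ → ℝ, ContinuousOn D' (Set.Ico (0:ℝ) 1) ∧
      ∀ m ∈ Set.Ico (0:ℝ) 1, HasDerivWithinAt D (D' m) (Set.Ico (0:ℝ) 1) m)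
    (LD0 LD1 : ℝ) (hLD0 : 0 < LD0) (hLD1 : 0 < LD1)
    (hD_zero : Filter.Tendsto (fun m => D m / m ^ a) (nhdsWithin 0 (Set.Ioi 0)) (nhds LD0))
    (hD_one : Filter.Tendsto (fun m => (1 - m) ^ b * D m) (nhdsWithin 1 (Set.Iio 1)) (nhds LD1))
    (sInf : ℝ) (hsInf_mem : sInf ∈ Set.Ioo (0:ℝ) 1)
    (hsInf_eq : sInf + lam * F sInf = 1)
    (hsInf_uniq : ∀ s ∈ Set.Ioo (0:ℝ) 1, s + lam * F s = 1 → s = sInf)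
    (sM : ℝ) (hsM_mem : sM ∈ Set.Ioo (0:ℝ) 1) (hsM_eq : f sM = lam)
    (hpar : sM + lam * F sM < 1 - gam)
    (G : ℝ → ℝ)
    (hG : ∀ s ∈ Set.Ioc (0:ℝ) 1, G s = ∫ ρ in s..1, (ρ + lam * F ρ - (1 - gam)) / f ρ)
    (hGpos : ∀ s ∈ Set.Ioo sInf 1, 0 < G s) :
    ∃! v : ℝ, 0 < v ∧ ∃ M S : ℝ → ℝ, IsTW lam gam v sInf f F D M S := by
  exact tw_main lam gam kap hlam hgam hkap f f' F hf_maps hf_mono hf_deriv hf'_cont hf_zero hf'_zero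
    hf_one hF D a b ha hb hD_mono hD_nonneg hD_smooth LD0 LD1 hLD0 hLD1 hD_zero hD_one sInf hsInf_mem
    hsInf_eq sM hsM_mem hsM_eq hpar G hG hGpos
end

section
/- Assume the parameter condition, and suppose 𝒢(s̄) < 0 for some s̄ ∈ (s₋∞,1). Then for every v > 0 there exists no travelling-wave solution with speed v. -/
theorem travelling_wave_nonexistence
    (lam gam kap : ℝ)
    (hlam : lam ∈ Set.Ioo (0:ℝ) 1) (hgam : gam ∈ Set.Ioo (0:ℝ) 1)
    (hkap : kap ∈ Set.Ioc (0:ℝ) 1)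
    (f f' F : ℝ → ℝ)
    (hf_maps : ∀ x ∈ Set.Icc (0:ℝ) 1, f x ∈ Set.Icc (0:ℝ) 1)
    (hf_mono : StrictMonoOn f (Set.Icc (0:ℝ) 1))
    (hf_deriv : ∀ x ∈ Set.Icc (0:ℝ) 1, HasDerivWithinAt f (f' x) (Set.Icc (0:ℝ) 1) x)
    (hf'_cont : ContinuousOn f' (Set.Icc (0:ℝ) 1))
    (hf_zero : f 0 = 0) (hf'_zero : f' 0 = 1 / kap)
    (hf_one : f 1 ∈ Set.Ioc lam 1)
    (hF : ∀ s ∈ Set.Ioc (0:ℝ) 1, F s = ∫ ρ in s..1, 1 / f ρ)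
    (D : ℝ → ℝ) (a b : ℝ) (ha : 1 < a) (hb : 1 < b)
    (hD_mono : MonotoneOn D (Set.Ico (0:ℝ) 1))
    (hD_nonneg : ∀ m ∈ Set.Ico (0:ℝ) 1, 0 ≤ D m)
    (hD_smooth : ∃ D' : ℝ → ℝ, ContinuousOn D' (Set.Ico (0:ℝ) 1) ∧
      ∀ m ∈ Set.Ico (0:ℝ) 1, HasDerivWithinAt D (D' m) (Set.Ico (0:ℝ) 1) m)
    (LD0 LD1 : ℝ) (hLD0 : 0 < LD0) (hLD1 : 0 < LD1)
    (hD_zero : Filter.Tendsto (fun m => D m / m ^ a) (nhdsWithin 0 (Set.Ioi 0)) (nhds LD0))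
    (hD_one : Filter.Tendsto (fun m => (1 - m) ^ b * D m) (nhdsWithin 1 (Set.Iio 1)) (nhds LD1))
    (sInf : ℝ) (hsInf_mem : sInf ∈ Set.Ioo (0:ℝ) 1)
    (hsInf_eq : sInf + lam * F sInf = 1)
    (hsInf_uniq : ∀ s ∈ Set.Ioo (0:ℝ) 1, s + lam * F s = 1 → s = sInf)
    (sM : ℝ) (hsM_mem : sM ∈ Set.Ioo (0:ℝ) 1) (hsM_eq : f sM = lam)
    (hpar : sM + lam * F sM < 1 - gam)
    (G : ℝ → ℝ)
    (hG : ∀ s ∈ Set.Ioc (0:ℝ) 1, G s = ∫ ρ in s..1, (ρ + lam * F ρ - (1 - gam)) / f ρ)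
    (sbar : ℝ) (hsbar : sbar ∈ Set.Ioo sInf 1) (hGneg : G sbar < 0) :
    ∀ v : ℝ, 0 < v → ¬ ∃ M S : ℝ → ℝ, IsTW lam gam v sInf f F D M S := by
  rintro v hv ⟨M, S, hM, hS, hMc, hSd, hMd, h0, -, hSlim⟩
  have hg := hgam.1
  have hsb0 : 0 < sbar := hsInf_mem.1.trans hsbar.1
  have hsb1 : sbar < 1 := hsbar.2
  have hSc : Continuous S := continuous_iff_continuousAt.2 fun x => (hSd x).continuousAt
  have hfpos : ∀ x ∈ Set.Ioc (0:ℝ) 1, 0 < f x := by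
    intro x hx
    have := hf_mono (by simp) (Set.Ioc_subset_Icc_self hx) hx.1
    rwa [hf_zero] at this
  have hfc : ContinuousOn f (Set.Icc 0 1) := fun x hx => (hf_deriv x hx).continuousWithinAt
  have hsub : Set.Icc sbar 1 ⊆ Set.Ioc (0:ℝ) 1 := fun x hx => ⟨hsb0.trans_le hx.1, hx.2⟩
  have hfc' : ContinuousOn f (Set.Icc sbar 1) :=
    hfc.mono (hsub.trans Set.Ioc_subset_Icc_self)
  have hprim : ∀ k : ℝ → ℝ, ContinuousOn k (Set.Icc sbar 1) → ∃ w : ℝ → ℝ, Continuous w ∧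
      (∀ x ∈ Set.Icc sbar 1, w x = k x) ∧
      (∀ s ∈ Set.Icc sbar 1, (∫ ρ in s..1, k ρ) = -∫ ρ in (1:ℝ)..s, w ρ) := by
    intro k hk
    refine ⟨Set.IccExtend hsb1.le ((Set.Icc sbar 1).restrict k), ?_, ?_, ?_⟩
    · exact (continuousOn_iff_continuous_restrict.1 hk).Icc_extend'
    · intro x hx
      rw [Set.IccExtend_of_mem _ _ hx]; rfl
    · intro s hs
      rw [← intervalIntegral.integral_symm]
      apply intervalIntegral.integral_congr
      intro x hx
      rw [Set.uIcc_of_le hs.2] at hx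
      have hx' : x ∈ Set.Icc sbar 1 := ⟨hs.1.trans hx.1, hx.2⟩
      simp only [Set.IccExtend_of_mem _ _ hx']; rfl
  have hFc : ContinuousOn F (Set.Icc sbar 1) := by
    obtain ⟨w, hw, -, hw2⟩ := hprim (fun ρ => 1 / f ρ)
      (continuousOn_const.div hfc' fun x hx => (hfpos x (hsub hx)).ne')
    have : Continuous fun s => -∫ ρ in (1:ℝ)..s, w ρ :=
      (intervalIntegral.continuous_primitive (fun a b => hw.intervalIntegrable a b) 1).neg
    refine this.continuousOn.congr fun s hs => ?_
    rw [hF s (hsub hs), hw2 s hs]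
  obtain ⟨w, hw, hw1, hw2⟩ := hprim (fun ρ => (ρ + lam * F ρ - (1 - gam)) / f ρ)
    (((continuousOn_id.add (continuousOn_const.mul hFc)).sub continuousOn_const).div hfc'
      fun x hx => (hfpos x (hsub hx)).ne')
  -- crossing point
  obtain ⟨x0, hx0, hx0S⟩ : ∃ x0 ≤ (0:ℝ), S x0 = sbar := by
    obtain ⟨y, hy, hy0⟩ := ((hSlim.eventually (gt_mem_nhds hsbar.1)).and
      (Filter.eventually_le_atBot (0:ℝ))).exists
    have := intermediate_value_Icc hy0 hSc.continuousOn
    obtain ⟨x, hx, hxs⟩ := this ⟨hy.le, by rw [(h0 0 le_rfl).2]; exact hsb1.le⟩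
    exact ⟨x, hx.2, hxs⟩
  have hSmono : Monotone S := by
    apply monotone_of_deriv_nonneg fun x => (hSd x).differentiableAt
    intro x
    rw [(hSd x).deriv]
    have := hfpos _ (hS x)
    have := (hM x).1
    positivity
  obtain ⟨xm, hxm, hmax⟩ := (isCompact_Icc (a := x0) (b := (0:ℝ))).exists_isMaxOn
    ⟨x0, by simp [hx0]⟩ hMc.continuousOn
  obtain ⟨D', -, hD'⟩ := hD_smooth
  have hm0 : 0 ≤ M xm := (hM xm).1
  have hsubD : Set.Icc 0 (M xm) ⊆ Set.Ico (0:ℝ) 1 := fun x hx => ⟨hx.1, hx.2.trans_lt (hM xm).2⟩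
  have hDc : ContinuousOn (fun x => x * D x) (Set.Icc 0 (M xm)) :=
    continuousOn_id.mul fun x hx => ((hD' x (hsubD hx)).continuousWithinAt).mono hsubD
  obtain ⟨q, hq, hq1, hq0⟩ : ∃ q : ℝ → ℝ, Continuous q ∧
      (∀ x ∈ Set.Icc 0 (M xm), q x = x * D x) ∧ ∀ x, 0 ≤ q x := by
    refine ⟨Set.IccExtend hm0 ((Set.Icc 0 (M xm)).restrict (fun x => x * D x)), ?_, ?_, ?_⟩
    · exact (continuousOn_iff_continuous_restrict.1 hDc).Icc_extend'
    · intro x hx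
      rw [Set.IccExtend_of_mem _ _ hx]; rfl
    · intro x
      have hp := (Set.projIcc 0 (M xm) hm0 x).2
      exact mul_nonneg hp.1 (hD_nonneg _ (hsubD hp))
  have hPd : ∀ m, HasDerivAt (fun m => ∫ x in (0:ℝ)..m, q x) (q m) m := fun m =>
    hq.deriv_integral q 0 m ▸ (hq.integral_hasStrictDerivAt 0 m).hasDerivAt.differentiableAt.hasDerivAt
  have hWd : ∀ s, HasDerivAt (fun s => ∫ x in (1:ℝ)..s, w x) (w s) s := fun s =>
    (hw.integral_hasStrictDerivAt 1 s).hasDerivAt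
  set P : ℝ → ℝ := fun m => ∫ x in (0:ℝ)..m, q x with hP
  set W : ℝ → ℝ := fun s => ∫ x in (1:ℝ)..s, w x with hW
  have hP0 : ∀ m, 0 ≤ m → 0 ≤ P m := fun m hm =>
    intervalIntegral.integral_nonneg hm fun x _ => hq0 x
  have hPz : P 0 = 0 := by simp [hP]
  have hWS : ∀ x, HasDerivAt (fun x => -(v / gam)^2 * W (S x))
      (-(v / gam)^2 * (w (S x) * (gam / v * (f (S x) * M x)))) x := fun x =>
    ((hWd (S x)).comp x (hSd x)).const_mul _
  have hPc : Continuous P := continuous_iff_continuousAt.2 fun x => (hPd x).continuousAt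
  have hWc : Continuous W := continuous_iff_continuousAt.2 fun x => (hWd x).continuousAt
  have key := image_le_of_liminf_slope_right_le_deriv_boundary
    (f := fun x => -(v / gam)^2 * W (S x) - P (M x)) (a := x0) (b := 0)
    (B := fun _ => -(v / gam)^2 * W (S x0) - P (M x0)) (B' := fun _ => 0)
    (by fun_prop) le_rfl continuousOn_const
    (fun x _ => hasDerivWithinAt_const _ _ _)
    (by
      intro x hx r hr
      apply Filter.Eventually.frequently
      rcases (hM x).1.eq_or_lt with hz | hpos
      · have h1 := (hWS x)
        rw [← hz] at h1
        simp only [mul_zero] at h1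
        have h2 := (hasDerivAt_iff_tendsto_slope.1 h1).mono_left
          (nhdsWithin_mono x (fun y (hy : x < y) => hy.ne'))
        filter_upwards [h2.eventually (gt_mem_nhds hr), self_mem_nhdsWithin] with z hz1 hz2
        refine lt_of_le_of_lt ?_ hz1
        have hz2' : 0 < z - x := sub_pos.2 hz2
        rw [slope_def_field, slope_def_field]
        apply div_le_div_of_nonneg_right _ hz2'.le
        have := hP0 _ (hM z).1
        rw [← hz, hPz]
        linarith
      · obtain ⟨M', hM', hode⟩ := hMd x hpos
        have h1 := (hWS x).sub ((hPd (M x)).comp x hM')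
        have h2 := (hasDerivAt_iff_tendsto_slope.1 h1).mono_left
          (nhdsWithin_mono x (fun y (hy : x < y) => hy.ne'))
        refine h2.eventually (gt_mem_nhds (lt_of_le_of_lt ?_ hr))
        have hxI : x ∈ Set.Icc x0 0 := Set.Ico_subset_Icc_self hx
        have hSx : S x ∈ Set.Icc sbar 1 := ⟨hx0S ▸ hSmono hx.1, (hS x).2⟩
        rw [hw1 _ hSx, hq1 _ ⟨hpos.le, hmax hxI⟩, mul_assoc (M x), hode]
        have hf0 := (hfpos _ (hsub hSx)).ne'
        have : -(v / gam) ^ 2 * ((S x + lam * F (S x) - (1 - gam)) / f (S x) *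
            (gam / v * (f (S x) * M x))) -
            M x * (v / gam * (1 - S x - lam * F (S x) - gam * M x)) = - (v * (M x * (1 - M x))) := by
          field_simp
          ring
        rw [this]
        have := mul_nonneg hv.le (mul_nonneg hpos.le (sub_nonneg.2 (hM x).2.le))
        linarith)
    (x := 0) ⟨hx0, le_rfl⟩
  have hW1 : W 1 = 0 := by simp [hW]
  simp only [(h0 0 le_rfl).1, (h0 0 le_rfl).2, hW1, hPz, hx0S] at key
  have hGW : G sbar = - W sbar := by
    rw [hG _ ⟨hsb0, hsb1.le⟩]; exact hw2 _ ⟨le_rfl, hsb1.le⟩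
  have h3 := hP0 _ (hM x0).1
  have h4 : (v / gam)^2 * G sbar < 0 := mul_neg_of_pos_of_neg (by positivity) hGneg
  rw [hGW] at h4
  linarith
end

section
/- Let λ ≥ 1 and let f : [0,1] → [0,1] be a strictly increasing C¹ function with f(0) = 0. Then there is no s ∈ (0,1) with s + λ F(s) = 1, where F(s) = ∫_s^1 dρ/f(ρ); consequently the left boundary state s₋∞ ∈ (0,1) required for a travelling wave does not exist. -/
theorem no_left_state_for_large_lambda
    (lam : ℝ) (hlam : 1 ≤ lam)
    (f f' F : ℝ → ℝ)
    (hf_maps : ∀ x ∈ Set.Icc (0:ℝ) 1, f x ∈ Set.Icc (0:ℝ) 1)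
    (hf_mono : StrictMonoOn f (Set.Icc (0:ℝ) 1))
    (hf_deriv : ∀ x ∈ Set.Icc (0:ℝ) 1, HasDerivWithinAt f (f' x) (Set.Icc (0:ℝ) 1) x)
    (hf'_cont : ContinuousOn f' (Set.Icc (0:ℝ) 1))
    (hf_zero : f 0 = 0)
    (hF : ∀ s ∈ Set.Ioc (0:ℝ) 1, F s = ∫ ρ in s..1, 1 / f ρ) :
    ¬ ∃ s ∈ Set.Ioo (0:ℝ) 1, s + lam * F s = 1 := by
  rintro ⟨s, ⟨hs0, hs1⟩, h⟩
  have hsub : Set.Icc s 1 ⊆ Set.Icc (0:ℝ) 1 := Set.Icc_subset_Icc_left hs0.le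
  have hpos : ∀ x ∈ Set.Icc s 1, 0 < f x := fun x hx => by
    have := hf_mono (by simp) (hsub hx) (lt_of_lt_of_le hs0 hx.1)
    rwa [hf_zero] at this
  have hc : ContinuousOn (fun x => 1 / f x) (Set.Icc s 1) :=
    continuousOn_const.div (fun x hx => ((hf_deriv x (hsub hx)).continuousWithinAt).mono hsub)
      (fun x hx => (hpos x hx).ne')
  have hsm : s ∈ Set.Icc s 1 := ⟨le_rfl, hs1.le⟩
  have hlt : f s < 1 :=
    lt_of_lt_of_le (hf_mono (hsub hsm) (by simp) hs1) (hf_maps 1 (by simp)).2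
  have key : ∫ ρ in s..1, (1:ℝ) < ∫ ρ in s..1, 1 / f ρ := by
    refine intervalIntegral.integral_lt_integral_of_continuousOn_of_le_of_exists_lt hs1
      continuousOn_const hc (fun x hx => ?_) ⟨s, hsm, ?_⟩
    · have hx' : x ∈ Set.Icc s 1 := ⟨hx.1.le, hx.2⟩
      exact (one_le_div (hpos x hx')).2 (hf_maps x (hsub hx')).2
    · exact (one_lt_div (hpos s hsm)).2 hlt
  rw [← hF s ⟨hs0, hs1.le⟩] at key
  simp at key
  nlinarith
end
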